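/- arXiv:1309.1656 — 7 statements merged into one kernel-verified Lean document; each statement's English description precedes it below -/
import Mathlib

section
/- For every dimension d ≥ 1 the map (β, ν₁, ν₂, u) ↦ (ρ₁, ρ₂, P, E) from (0,∞) × ℝ × ℝ × ℝ^d to ℝ × ℝ × ℝ^d × ℝ is injective, where ρ_σ = ∫_{ℝ^d} (exp(β|p−u|²/2 − ν_σ) + 1)^{−1} dp for σ = 1,2, P = u·(ρ₁+ρ₂), and E = ∫_{ℝ^d} (|p|²/2) [(exp(β|p−u|²/2 − ν₁)+1)^{−1} + (exp(β|p−u|²/2 − ν₂)+1)^{−1}] dp. In other words, the density, momentum and energy moments of a (diagonal) Fermi-Dirac distribution with dispersion ω(p) = |p|²/2 uniquely determine its parameters (β, ν₁, ν₂, u). -/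
open MeasureTheory

/-- Density moment of a Fermi-Dirac distribution with inverse temperature `β`,
rescaled chemical potential `ν` and drift `u`. -/
noncomputable def fdDensity (d : ℕ) (β ν : ℝ) (u : EuclideanSpace ℝ (Fin d)) : ℝ :=
  ∫ p : EuclideanSpace ℝ (Fin d), (Real.exp (β * ‖p - u‖ ^ 2 / 2 - ν) + 1)⁻¹

/-- Energy moment of a two-component Fermi-Dirac distribution. -/
noncomputable def fdEnergy (d : ℕ) (β ν₁ ν₂ : ℝ) (u : EuclideanSpace ℝ (Fin d)) : ℝ :=
  ∫ p : EuclideanSpace ℝ (Fin d), (‖p‖ ^ 2 / 2) *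
    ((Real.exp (β * ‖p - u‖ ^ 2 / 2 - ν₁) + 1)⁻¹ +
     (Real.exp (β * ‖p - u‖ ^ 2 / 2 - ν₂) + 1)⁻¹)

section FermiDirac

variable {E : Type*} [NormedAddCommGroup E]

/-- The Fermi-Dirac distribution with zero drift. -/
noncomputable def fermiDirac (β ν : ℝ) (q : E) : ℝ :=
  (Real.exp (β * ‖q‖ ^ 2 / 2 - ν) + 1)⁻¹

lemma fermiDirac_pos (β ν : ℝ) (q : E) : 0 < fermiDirac β ν q := by
  unfold fermiDirac; positivity

lemma continuous_fermiDirac (β ν : ℝ) : Continuous (fermiDirac (E := E) β ν) := by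
  unfold fermiDirac
  exact Continuous.inv₀ (by fun_prop) fun q => by positivity

lemma fermiDirac_neg (β ν : ℝ) (q : E) : fermiDirac β ν (-q) = fermiDirac β ν q := by
  simp [fermiDirac]

lemma fermiDirac_lt_fermiDirac_iff {β ν β' ν' : ℝ} {q : E} :
    fermiDirac β ν q < fermiDirac β' ν' q ↔
      β' * ‖q‖ ^ 2 / 2 - ν' < β * ‖q‖ ^ 2 / 2 - ν := by
  unfold fermiDirac
  rw [inv_lt_inv₀ (by positivity) (by positivity), add_lt_add_iff_right, Real.exp_lt_exp]

lemma fermiDirac_le_exp (β ν : ℝ) (q : E) :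
    fermiDirac β ν q ≤ Real.exp ν * Real.exp (-(β / 2) * ‖q‖ ^ 2) := by
  rw [← Real.exp_add, show ν + -(β / 2) * ‖q‖ ^ 2 = -(β * ‖q‖ ^ 2 / 2 - ν) by ring, Real.exp_neg]
  exact inv_anti₀ (Real.exp_pos _) (by linarith)

lemma sq_norm_mul_fermiDirac_le_exp {β : ℝ} (hβ : 0 < β) (ν : ℝ) (q : E) :
    ‖q‖ ^ 2 * fermiDirac β ν q ≤
      (4 / β * Real.exp ν) * Real.exp (-(β / 4) * ‖q‖ ^ 2) := by
  have hx : ‖q‖ ^ 2 ≤ 4 / β * Real.exp (β / 4 * ‖q‖ ^ 2) := by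
    have := Real.add_one_le_exp (β / 4 * ‖q‖ ^ 2)
    calc ‖q‖ ^ 2 = 4 / β * (β / 4 * ‖q‖ ^ 2) := by field_simp
      _ ≤ _ := by gcongr; linarith
  calc ‖q‖ ^ 2 * fermiDirac β ν q
      ≤ (4 / β * Real.exp (β / 4 * ‖q‖ ^ 2)) *
          (Real.exp ν * Real.exp (-(β / 2) * ‖q‖ ^ 2)) :=
        mul_le_mul hx (fermiDirac_le_exp β ν q) (fermiDirac_pos β ν q).le (by positivity)
    _ = (4 / β * Real.exp ν) *
          (Real.exp (β / 4 * ‖q‖ ^ 2) * Real.exp (-(β / 2) * ‖q‖ ^ 2)) := by ring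
    _ = _ := by rw [← Real.exp_add]; ring_nf

variable [InnerProductSpace ℝ E]

lemma sq_norm_add_mul_fermiDirac (β ν : ℝ) (u q : E) :
    ‖q + u‖ ^ 2 * fermiDirac β ν q = ‖q‖ ^ 2 * fermiDirac β ν q +
      2 * (inner ℝ q u * fermiDirac β ν q) + ‖u‖ ^ 2 * fermiDirac β ν q := by
  rw [norm_add_sq_real]; ring

variable [FiniteDimensional ℝ E] [MeasurableSpace E] [BorelSpace E]

lemma integrable_exp_neg_mul_sq_norm {b : ℝ} (hb : 0 < b) :
    Integrable fun q : E => Real.exp (-b * ‖q‖ ^ 2) := by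
  have h := (GaussianFourier.integrable_cexp_neg_mul_sq_norm_add (V := E) (b := (b : ℂ))
    (by simpa using hb) 0 0).norm
  refine h.congr (Filter.Eventually.of_forall fun q => ?_)
  simp [Complex.norm_exp, ← Complex.ofReal_pow]

lemma integrable_fermiDirac {β : ℝ} (hβ : 0 < β) (ν : ℝ) :
    Integrable (fermiDirac (E := E) β ν) := by
  refine ((integrable_exp_neg_mul_sq_norm (half_pos hβ)).const_mul (Real.exp ν)).mono'
    (continuous_fermiDirac β ν).aestronglyMeasurable (Filter.Eventually.of_forall fun q => ?_)
  rw [Real.norm_of_nonneg (fermiDirac_pos β ν q).le]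
  exact fermiDirac_le_exp β ν q

lemma integrable_sq_norm_mul_fermiDirac {β : ℝ} (hβ : 0 < β) (ν : ℝ) :
    Integrable fun q : E => ‖q‖ ^ 2 * fermiDirac β ν q := by
  refine ((integrable_exp_neg_mul_sq_norm (show 0 < β / 4 by positivity)).const_mul
    (4 / β * Real.exp ν)).mono'
    ((continuous_norm.pow 2).mul (continuous_fermiDirac β ν)).aestronglyMeasurable
    (Filter.Eventually.of_forall fun q => ?_)
  rw [Real.norm_of_nonneg (mul_nonneg (sq_nonneg _) (fermiDirac_pos β ν q).le)]
  exact sq_norm_mul_fermiDirac_le_exp hβ ν q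

lemma integrable_inner_mul_fermiDirac {β : ℝ} (hβ : 0 < β) (ν : ℝ) (u : E) :
    Integrable fun q : E => inner ℝ q u * fermiDirac β ν q := by
  refine ((integrable_sq_norm_mul_fermiDirac hβ ν).add
    ((integrable_fermiDirac hβ ν).const_mul (‖u‖ ^ 2))).mono'
    ((by fun_prop : Continuous fun q : E => inner ℝ q u).mul
      (continuous_fermiDirac β ν)).aestronglyMeasurable
    (Filter.Eventually.of_forall fun q => ?_)
  rw [norm_mul, Real.norm_of_nonneg (fermiDirac_pos β ν q).le, Pi.add_apply, ← add_mul]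
  refine mul_le_mul_of_nonneg_right ?_ (fermiDirac_pos β ν q).le
  have := norm_inner_le_norm (𝕜 := ℝ) q u
  nlinarith [sq_nonneg (‖q‖ - ‖u‖), sq_nonneg ‖q‖, sq_nonneg ‖u‖]

lemma integral_fermiDirac_pos {β : ℝ} (hβ : 0 < β) (ν : ℝ) :
    0 < ∫ q : E, fermiDirac β ν q :=
  integral_pos_of_integrable_nonneg_nonzero (x := 0) (continuous_fermiDirac β ν)
    (integrable_fermiDirac hβ ν) (fun q => (fermiDirac_pos β ν q).le) (fermiDirac_pos β ν 0).ne'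

lemma integral_inner_mul_fermiDirac (β ν : ℝ) (u : E) :
    ∫ q : E, inner ℝ q u * fermiDirac β ν q = 0 := by
  have h := integral_neg_eq_self (fun q : E => inner ℝ q u * fermiDirac β ν q) volume
  simp only [inner_neg_left, fermiDirac_neg, neg_mul, integral_neg] at h
  linarith

lemma integrable_sq_norm_add_mul_fermiDirac {β : ℝ} (hβ : 0 < β) (ν : ℝ) (u : E) :
    Integrable fun q : E => ‖q + u‖ ^ 2 * fermiDirac β ν q := by
  simp only [sq_norm_add_mul_fermiDirac]
  exact ((integrable_sq_norm_mul_fermiDirac hβ ν).add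
    ((integrable_inner_mul_fermiDirac hβ ν u).const_mul 2)).add
    ((integrable_fermiDirac hβ ν).const_mul _)

lemma integral_sq_norm_add_mul_fermiDirac {β : ℝ} (hβ : 0 < β) (ν : ℝ) (u : E) :
    ∫ q : E, ‖q + u‖ ^ 2 * fermiDirac β ν q =
      (∫ q : E, ‖q‖ ^ 2 * fermiDirac β ν q) + ‖u‖ ^ 2 * ∫ q : E, fermiDirac β ν q := by
  have h₁ := integrable_sq_norm_mul_fermiDirac (E := E) hβ ν
  have h₂ := (integrable_inner_mul_fermiDirac hβ ν u).const_mul 2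
  have h₃ := (integrable_fermiDirac (E := E) hβ ν).const_mul (‖u‖ ^ 2)
  have h₁₂ : Integrable fun q : E =>
      ‖q‖ ^ 2 * fermiDirac β ν q + 2 * (inner ℝ q u * fermiDirac β ν q) := h₁.add h₂
  simp only [sq_norm_add_mul_fermiDirac]
  rw [integral_add h₁₂ h₃, integral_add h₁ h₂, integral_const_mul, integral_const_mul,
    integral_inner_mul_fermiDirac, mul_zero, add_zero]

/-- The density is strictly increasing in the chemical potential. -/
lemma strictMono_integral_fermiDirac {β : ℝ} (hβ : 0 < β) :
    StrictMono fun ν => ∫ q : E, fermiDirac β ν q := by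
  intro ν ν' h
  have hlt : ∀ q : E, fermiDirac β ν q < fermiDirac β ν' q := fun q =>
    fermiDirac_lt_fermiDirac_iff.2 (by linarith)
  have hpos := integral_pos_of_integrable_nonneg_nonzero (μ := volume) (x := (0 : E))
    ((continuous_fermiDirac β ν').sub (continuous_fermiDirac β ν))
    ((integrable_fermiDirac hβ ν').sub (integrable_fermiDirac hβ ν))
    (fun q => (sub_pos.2 (hlt q)).le) (sub_pos.2 (hlt 0)).ne'
  simp only [Pi.sub_apply] at hpos
  rw [integral_sub (integrable_fermiDirac hβ ν') (integrable_fermiDirac hβ ν)] at hpos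
  exact sub_pos.1 hpos

/-- At fixed density, the thermal energy is strictly decreasing in the inverse temperature. The two
distributions cross exactly at `‖q‖ ^ 2 = R`, so `(‖q‖ ^ 2 - R)` times their difference has a
constant sign. -/
lemma integral_sq_norm_mul_fermiDirac_lt [Nontrivial E] {β β' ν ν' : ℝ} (hβ : 0 < β)
    (hββ' : β < β')
    (hρ : ∫ q : E, fermiDirac β ν q = ∫ q : E, fermiDirac β' ν' q) :
    ∫ q : E, ‖q‖ ^ 2 * fermiDirac β' ν' q < ∫ q : E, ‖q‖ ^ 2 * fermiDirac β ν q := by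
  have hβ' := hβ.trans hββ'
  obtain ⟨R, hR⟩ : ∃ R, (β' - β) * R = 2 * (ν' - ν) :=
    ⟨_, mul_div_cancel₀ _ (sub_pos.2 hββ').ne'⟩
  have hgt : ∀ q : E, R < ‖q‖ ^ 2 → fermiDirac β' ν' q < fermiDirac β ν q := fun q hq =>
    fermiDirac_lt_fermiDirac_iff.2 (by nlinarith)
  have hlt : ∀ q : E, ‖q‖ ^ 2 < R → fermiDirac β ν q < fermiDirac β' ν' q := fun q hq =>
    fermiDirac_lt_fermiDirac_iff.2 (by nlinarith)
  let D : E → ℝ := fun q => (‖q‖ ^ 2 * fermiDirac β ν q - ‖q‖ ^ 2 * fermiDirac β' ν' q) -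
    R * (fermiDirac β ν q - fermiDirac β' ν' q)
  have hD : ∀ q, D q = (‖q‖ ^ 2 - R) * (fermiDirac β ν q - fermiDirac β' ν' q) := fun q => by
    simp only [D]; ring
  have h₁ := integrable_sq_norm_mul_fermiDirac (E := E) hβ ν
  have h₂ := integrable_sq_norm_mul_fermiDirac (E := E) hβ' ν'
  have h₃ := integrable_fermiDirac (E := E) hβ ν
  have h₄ := integrable_fermiDirac (E := E) hβ' ν'
  have hcont : Continuous D := by
    have := continuous_fermiDirac (E := E) β ν
    have := continuous_fermiDirac (E := E) β' ν'
    fun_prop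
  have hnonneg : 0 ≤ D := fun q => by
    rw [Pi.zero_apply, hD]
    rcases lt_trichotomy (‖q‖ ^ 2) R with h | h | h
    · exact mul_nonneg_of_nonpos_of_nonpos (sub_nonpos.2 h.le) (sub_nonpos.2 (hlt q h).le)
    · simp [h]
    · exact mul_nonneg (sub_nonneg.2 h.le) (sub_nonneg.2 (hgt q h).le)
  obtain ⟨q₀, hq₀⟩ := exists_norm_eq E (show 0 ≤ |R| + 1 by positivity)
  have hq₀R : R < ‖q₀‖ ^ 2 := by
    rw [hq₀]; nlinarith [le_abs_self R, abs_nonneg R]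
  have hpos : 0 < ∫ q, D q :=
    integral_pos_of_integrable_nonneg_nonzero hcont ((h₁.sub h₂).sub ((h₃.sub h₄).const_mul R))
      hnonneg (x := q₀)
      (by rw [hD]; exact (mul_pos (sub_pos.2 hq₀R) (sub_pos.2 (hgt q₀ hq₀R))).ne')
  have hint : ∫ q, D q = ((∫ q : E, ‖q‖ ^ 2 * fermiDirac β ν q) -
      ∫ q : E, ‖q‖ ^ 2 * fermiDirac β' ν' q) -
      R * ((∫ q : E, fermiDirac β ν q) - ∫ q : E, fermiDirac β' ν' q) := by
    rw [← integral_sub h₁ h₂, ← integral_sub h₃ h₄, ← integral_const_mul]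
    exact integral_sub (h₁.sub h₂) ((h₃.sub h₄).const_mul R)
  rw [hint, hρ, sub_self, mul_zero, sub_zero] at hpos
  exact sub_pos.1 hpos

end FermiDirac

lemma fdDensity_eq (d : ℕ) (β ν : ℝ) (u : EuclideanSpace ℝ (Fin d)) :
    fdDensity d β ν u = ∫ q : EuclideanSpace ℝ (Fin d), fermiDirac β ν q :=
  integral_sub_right_eq_self (fermiDirac β ν) u

lemma fdEnergy_eq (d : ℕ) {β : ℝ} (hβ : 0 < β) (ν₁ ν₂ : ℝ) (u : EuclideanSpace ℝ (Fin d)) :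
    fdEnergy d β ν₁ ν₂ u =
      ((∫ q : EuclideanSpace ℝ (Fin d), ‖q‖ ^ 2 * fermiDirac β ν₁ q) +
        (∫ q : EuclideanSpace ℝ (Fin d), ‖q‖ ^ 2 * fermiDirac β ν₂ q) +
        ‖u‖ ^ 2 * (fdDensity d β ν₁ u + fdDensity d β ν₂ u)) / 2 := by
  have h : fdEnergy d β ν₁ ν₂ u = ∫ q : EuclideanSpace ℝ (Fin d),
      (‖q + u‖ ^ 2 * fermiDirac β ν₁ q + ‖q + u‖ ^ 2 * fermiDirac β ν₂ q) / 2 := by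
    rw [fdEnergy, ← integral_add_right_eq_self _ u]
    congr with q
    simp only [add_sub_cancel_right, fermiDirac]
    ring
  rw [h, integral_div, integral_add (integrable_sq_norm_add_mul_fermiDirac hβ ν₁ u)
    (integrable_sq_norm_add_mul_fermiDirac hβ ν₂ u), integral_sq_norm_add_mul_fermiDirac hβ,
    integral_sq_norm_add_mul_fermiDirac hβ, fdDensity_eq, fdDensity_eq]
  ring

/-- The map `(β, ν₁, ν₂, u) ↦ (ρ₁, ρ₂, P, E)` is injective on
`(0,∞) × ℝ × ℝ × ℝ^d`: the density, momentum and energy moments of a diagonal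
Fermi-Dirac distribution uniquely determine its parameters. -/
theorem fermiDirac_moments_injective (d : ℕ) (hd : 1 ≤ d) :
    Set.InjOn
      (fun x : ℝ × ℝ × ℝ × EuclideanSpace ℝ (Fin d) =>
        (fdDensity d x.1 x.2.1 x.2.2.2,
         fdDensity d x.1 x.2.2.1 x.2.2.2,
         (fdDensity d x.1 x.2.1 x.2.2.2 + fdDensity d x.1 x.2.2.1 x.2.2.2) • x.2.2.2,
         fdEnergy d x.1 x.2.1 x.2.2.1 x.2.2.2))
      {x : ℝ × ℝ × ℝ × EuclideanSpace ℝ (Fin d) | 0 < x.1} := by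
  rintro ⟨β, ν₁, ν₂, u⟩ hβ ⟨β', ν₁', ν₂', u'⟩ hβ' h
  simp only [Set.mem_ofPred_eq, Prod.mk.injEq] at hβ hβ' h
  obtain ⟨h₁, h₂, hP, hE⟩ := h
  have : Nonempty (Fin d) := ⟨⟨0, hd⟩⟩
  have hρ : 0 < fdDensity d β' ν₁' u' + fdDensity d β' ν₂' u' := by
    rw [fdDensity_eq, fdDensity_eq]
    exact add_pos (integral_fermiDirac_pos hβ' _) (integral_fermiDirac_pos hβ' _)
  rw [h₁, h₂] at hP
  obtain rfl : u = u' := smul_right_injective _ hρ.ne' hP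
  rw [fdEnergy_eq d hβ, fdEnergy_eq d hβ', h₁, h₂] at hE
  rw [fdDensity_eq, fdDensity_eq] at h₁ h₂
  obtain rfl : β = β' := by
    rcases lt_trichotomy β β' with h | h | h
    · linarith [integral_sq_norm_mul_fermiDirac_lt hβ h h₁,
        integral_sq_norm_mul_fermiDirac_lt hβ h h₂]
    · exact h
    · linarith [integral_sq_norm_mul_fermiDirac_lt hβ' h h₁.symm,
        integral_sq_norm_mul_fermiDirac_lt hβ' h h₂.symm]
  rw [(strictMono_integral_fermiDirac hβ).injective h₁,
    (strictMono_integral_fermiDirac hβ).injective h₂]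
end

section
/- For every dimension d ≥ 1, the free energy H(β, ν₁, ν₂) = ∫_{ℝ^d} [log(1 + e^{ν₁ − β|p|²/2}) + log(1 + e^{ν₂ − β|p|²/2})] dp is a strictly convex function of (β, ν₁, ν₂) on the domain (0,∞) × ℝ × ℝ. -/
open MeasureTheory

/-- The free energy `H(β, ν₁, ν₂) = ∫_{ℝ^d} [log(1 + e^{ν₁ - β|p|²/2}) + log(1 + e^{ν₂ - β|p|²/2})] dp`. -/
noncomputable def freeEnergyH (d : ℕ) (x : ℝ × ℝ × ℝ) : ℝ :=
  ∫ p : EuclideanSpace ℝ (Fin d),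
    (Real.log (1 + Real.exp (x.2.1 - x.1 * ‖p‖ ^ 2 / 2)) +
     Real.log (1 + Real.exp (x.2.2 - x.1 * ‖p‖ ^ 2 / 2)))

theorem strictConvexOn_log_one_add_exp :
    StrictConvexOn ℝ Set.univ (fun t : ℝ => Real.log (1 + Real.exp t)) := by
  have hderiv : deriv (fun t : ℝ => Real.log (1 + Real.exp t)) =
      fun t => Real.exp t / (1 + Real.exp t) := by
    ext t
    exact (((Real.hasDerivAt_exp t).const_add 1).log (by positivity)).deriv
  refine StrictMono.strictConvexOn_univ_of_deriv
    (Continuous.log (by fun_prop) fun t => by positivity) ?_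
  rw [hderiv]
  intro s t hst
  have := Real.exp_lt_exp.2 hst
  simp only
  rw [div_lt_div_iff₀ (by positivity) (by positivity)]
  linarith

theorem continuous_log_one_add_exp_sub_norm_sq {E : Type*} [NormedAddCommGroup E] (β ν : ℝ) :
    Continuous fun p : E => Real.log (1 + Real.exp (ν - β * ‖p‖ ^ 2 / 2)) :=
  Continuous.log (by fun_prop) fun p => by positivity

theorem integrable_log_one_add_exp_sub_norm_sq {E : Type*} [NormedAddCommGroup E]
    [InnerProductSpace ℝ E] [FiniteDimensional ℝ E] [MeasurableSpace E] [BorelSpace E]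
    {β : ℝ} (hβ : 0 < β) (ν : ℝ) :
    Integrable fun p : E => Real.log (1 + Real.exp (ν - β * ‖p‖ ^ 2 / 2)) := by
  have hgauss : Integrable fun p : E => Real.exp (-(β / 2) * ‖p‖ ^ 2) := by
    have h := (GaussianFourier.integrable_cexp_neg_mul_sq_norm_add (V := E) (b := (β / 2 : ℝ))
      (by simpa using hβ) 0 0).norm
    refine h.congr (Filter.Eventually.of_forall fun p => ?_)
    simp only [Complex.norm_exp]
    congr 1
    simp [← Complex.ofReal_pow]
  refine (hgauss.const_mul (Real.exp ν)).mono'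
    (continuous_log_one_add_exp_sub_norm_sq β ν).aestronglyMeasurable
    (Filter.Eventually.of_forall fun p => ?_)
  have hpos := Real.exp_pos (ν - β * ‖p‖ ^ 2 / 2)
  rw [Real.norm_of_nonneg (Real.log_nonneg (by linarith)), ← Real.exp_add]
  calc Real.log (1 + Real.exp (ν - β * ‖p‖ ^ 2 / 2))
      ≤ Real.exp (ν - β * ‖p‖ ^ 2 / 2) := by
        have := Real.log_le_sub_one_of_pos (add_pos one_pos hpos)
        linarith
    _ = Real.exp (ν + -(β / 2) * ‖p‖ ^ 2) := by ring_nf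

/-- For every dimension `d ≥ 1`, the free energy `H` is strictly convex on
`(0,∞) × ℝ × ℝ`. -/
theorem freeEnergy_strictConvexOn (d : ℕ) (hd : 1 ≤ d) :
    StrictConvexOn ℝ {x : ℝ × ℝ × ℝ | 0 < x.1} (freeEnergyH d) := by
  have hconvex : Convex ℝ {x : ℝ × ℝ × ℝ | 0 < x.1} :=
    (convex_Ioi (0 : ℝ)).linear_preimage (LinearMap.fst ℝ ℝ (ℝ × ℝ))
  refine ⟨hconvex, fun x hx y hy hxy a b ha hb hab => ?_⟩
  have hz := hconvex hx hy ha.le hb.le hab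
  let F (x : ℝ × ℝ × ℝ) (p : EuclideanSpace ℝ (Fin d)) : ℝ :=
    Real.log (1 + Real.exp (x.2.1 - x.1 * ‖p‖ ^ 2 / 2)) +
      Real.log (1 + Real.exp (x.2.2 - x.1 * ‖p‖ ^ 2 / 2))
  have hcont (x) : Continuous (F x) :=
    (continuous_log_one_add_exp_sub_norm_sq _ _).add (continuous_log_one_add_exp_sub_norm_sq _ _)
  have hint {x : ℝ × ℝ × ℝ} (hx : 0 < x.1) : Integrable (F x) :=
    (integrable_log_one_add_exp_sub_norm_sq hx _).add (integrable_log_one_add_exp_sub_norm_sq hx _)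
  have haff (ν ν' r : ℝ) : a * ν + b * ν' - (a * x.1 + b * y.1) * r ^ 2 / 2 =
      a * (ν - x.1 * r ^ 2 / 2) + b * (ν' - y.1 * r ^ 2 / 2) := by ring
  have hle (ν ν' r : ℝ) := strictConvexOn_log_one_add_exp.convexOn.2
    (Set.mem_univ (ν - x.1 * r ^ 2 / 2)) (Set.mem_univ (ν' - y.1 * r ^ 2 / 2)) ha.le hb.le hab
  have hlt (ν ν' r : ℝ) (h : ν - x.1 * r ^ 2 / 2 ≠ ν' - y.1 * r ^ 2 / 2) :=
    strictConvexOn_log_one_add_exp.2 (Set.mem_univ _) (Set.mem_univ _) h ha hb hab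
  simp only [smul_eq_mul, ← haff] at hle hlt
  have hnonneg : 0 ≤ fun p => a * F x p + b * F y p - F (a • x + b • y) p := by
    intro p
    have h₁ := hle x.2.1 y.2.1 ‖p‖
    have h₂ := hle x.2.2 y.2.2 ‖p‖
    simp only [F, Pi.zero_apply, Prod.fst_add, Prod.snd_add, Prod.smul_fst, Prod.smul_snd,
      smul_eq_mul]
    linarith
  have hpos : ∃ p, 0 < a * F x p + b * F y p - F (a • x + b • y) p := by
    obtain ⟨p, hp⟩ : ∃ p : EuclideanSpace ℝ (Fin d),
        x.2.1 - x.1 * ‖p‖ ^ 2 / 2 ≠ y.2.1 - y.1 * ‖p‖ ^ 2 / 2 ∨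
        x.2.2 - x.1 * ‖p‖ ^ 2 / 2 ≠ y.2.2 - y.1 * ‖p‖ ^ 2 / 2 := by
      by_contra! h
      obtain ⟨h₁, h₂⟩ := h 0
      have h₃ := (h (EuclideanSpace.single ⟨0, hd⟩ 1)).1
      simp only [norm_zero, PiLp.norm_single, norm_one] at h₁ h₂ h₃
      exact hxy (Prod.ext (by linarith) (Prod.ext (by linarith) (by linarith)))
    refine ⟨p, ?_⟩
    simp only [F, Prod.fst_add, Prod.snd_add, Prod.smul_fst, Prod.smul_snd, smul_eq_mul]
    rcases hp with hp | hp
    · linarith [hlt _ _ _ hp, hle x.2.2 y.2.2 ‖p‖]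
    · linarith [hlt _ _ _ hp, hle x.2.1 y.2.1 ‖p‖]
  obtain ⟨p, hp⟩ := hpos
  have hxi := (hint hx).const_mul a
  have hyi := (hint hy).const_mul b
  have hadd : Integrable fun p => a * F x p + b * F y p := hxi.add hyi
  have hsplit : ∫ p, (a * F x p + b * F y p - F (a • x + b • y) p) =
      a * freeEnergyH d x + b * freeEnergyH d y - freeEnergyH d (a • x + b • y) := by
    rw [integral_sub hadd (hint hz), integral_add hxi hyi, integral_const_mul,
      integral_const_mul]
    rfl
  have : 0 < ∫ p, (a * F x p + b * F y p - F (a • x + b • y) p) :=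
    integral_pos_of_integrable_nonneg_nonzero (x := p)
      ((((hcont x).const_mul a).add ((hcont y).const_mul b)).sub (hcont (a • x + b • y)))
      (hadd.sub (hint hz)) hnonneg hp.ne'
  rw [hsplit] at this
  simp only [smul_eq_mul]
  linarith
end

section
/- For every real k > 0, the complete Fermi-Dirac integral F_k is differentiable on ℝ and satisfies d/dx F_k(x) = F_{k−1}(x) for all x ∈ ℝ. -/
open MeasureTheory Real

/-- The complete Fermi-Dirac integral `F_k(x) = (1/Γ(k+1)) ∫₀^∞ y^k / (e^(y-x) + 1) dy`. -/
noncomputable def fermiDiracF (k x : ℝ) : ℝ :=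
  (Real.Gamma (k + 1))⁻¹ * ∫ y in Set.Ioi (0:ℝ), y ^ k / (Real.exp (y - x) + 1)

open Filter Topology in
lemma tendsto_rpow_mul_inv_exp_sub_add_one_atTop (k x : ℝ) :
    Tendsto (fun y : ℝ => y ^ k * (exp (y - x) + 1)⁻¹) atTop (𝓝 0) := by
  have h := (tendsto_rpow_mul_exp_neg_mul_atTop_nhds_zero k 1 one_pos).mul_const (exp x)
  rw [zero_mul] at h
  refine squeeze_zero' ?_ ?_ h
  · filter_upwards [eventually_gt_atTop 0] with y hy
    positivity
  · filter_upwards [eventually_gt_atTop 0] with y hy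
    rw [mul_assoc, ← exp_add, show -1 * y + x = -(y - x) by ring, exp_neg]
    gcongr
    linarith

lemma integrableOn_rpow_mul_exp_sub {k : ℝ} (hk : -1 < k) (c : ℝ) :
    IntegrableOn (fun y : ℝ => y ^ k * exp (c - y)) (Set.Ioi 0) := by
  have h := (GammaIntegral_convergent (s := k + 1) (by linarith)).mul_const (exp c)
  refine h.congr (Filter.Eventually.of_forall fun y => ?_)
  beta_reduce
  rw [add_sub_cancel_right, sub_eq_add_neg c y, exp_add]
  ring

lemma integrableOn_rpow_mul_inv_exp_sub_add_one {k : ℝ} (hk : -1 < k) (x : ℝ) :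
    IntegrableOn (fun y : ℝ => y ^ k * (exp (y - x) + 1)⁻¹) (Set.Ioi 0) := by
  refine (integrableOn_rpow_mul_exp_sub hk x).mono' (by fun_prop) ?_
  filter_upwards [ae_restrict_mem measurableSet_Ioi] with y (hy : 0 < y)
  rw [norm_of_nonneg (by positivity), ← neg_sub y x, exp_neg]
  gcongr
  linarith

lemma exp_sub_div_sq_le (x y : ℝ) : exp (y - x) / (exp (y - x) + 1) ^ 2 ≤ exp (x - y) := by
  have h := exp_pos (y - x)
  rw [← neg_sub y x, exp_neg, inv_eq_one_div, div_le_div_iff₀ (by positivity) h]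
  nlinarith

lemma hasDerivAt_integral_fermiDirac {k : ℝ} (hk : -1 < k) (x : ℝ) :
    IntegrableOn (fun y : ℝ => y ^ k * (exp (y - x) / (exp (y - x) + 1) ^ 2)) (Set.Ioi 0) ∧
    HasDerivAt (fun x => ∫ y in Set.Ioi (0 : ℝ), y ^ k * (exp (y - x) + 1)⁻¹)
      (∫ y in Set.Ioi (0 : ℝ), y ^ k * (exp (y - x) / (exp (y - x) + 1) ^ 2)) x := by
  refine hasDerivAt_integral_of_dominated_loc_of_deriv_le
    (F := fun x y : ℝ => y ^ k * (exp (y - x) + 1)⁻¹)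
    (F' := fun x y : ℝ => y ^ k * (exp (y - x) / (exp (y - x) + 1) ^ 2))
    (Iio_mem_nhds (lt_add_one x)) (.of_forall fun z => by fun_prop)
    (integrableOn_rpow_mul_inv_exp_sub_add_one hk x) (Measurable.aestronglyMeasurable (by fun_prop))
    ?_ (integrableOn_rpow_mul_exp_sub hk (x + 1)) ?_
  · filter_upwards [ae_restrict_mem measurableSet_Ioi] with y (hy : 0 < y) z (hz : z < x + 1)
    rw [norm_of_nonneg (by positivity)]
    gcongr
    exact (exp_sub_div_sq_le z y).trans (by gcongr)
  · refine .of_forall fun y z _ => ?_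
    have h := ((((hasDerivAt_id z).const_sub y).exp.add_const 1).inv
      (by positivity)).const_mul (y ^ k)
    simpa using h

open Filter Topology in
lemma integral_rpow_mul_exp_sub_div_sq {k : ℝ} (hk : 0 < k) (x : ℝ) :
    ∫ y in Set.Ioi (0 : ℝ), y ^ k * (exp (y - x) / (exp (y - x) + 1) ^ 2) =
      k * ∫ y in Set.Ioi (0 : ℝ), y ^ (k - 1) * (exp (y - x) + 1)⁻¹ := by
  have hcont : Continuous fun y : ℝ => y ^ k * (exp (y - x) + 1)⁻¹ :=
    (continuous_rpow_const hk.le).mul (Continuous.inv₀ (by fun_prop) fun y => by positivity)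
  have h_zero := (hcont.tendsto 0).mono_left (nhdsWithin_le_nhds (s := Set.Ioi 0))
  rw [zero_rpow hk.ne', zero_mul] at h_zero
  have h := integral_Ioi_mul_deriv_eq_deriv_mul (a := 0)
    (u := fun y : ℝ => y ^ k) (u' := fun y => k * y ^ (k - 1))
    (v := fun y => (exp (y - x) + 1)⁻¹) (v' := fun y => -(exp (y - x) / (exp (y - x) + 1) ^ 2))
    (fun y hy => hasDerivAt_rpow_const (Or.inl (ne_of_gt hy)))
    (fun y _ => by
      have h := (((hasDerivAt_id y).sub_const x).exp.add_const 1).inv (by positivity)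
      simpa [neg_div, Pi.inv_def] using h)
    (by simpa [Pi.mul_def, IntegrableOn] using
      (hasDerivAt_integral_fermiDirac (by linarith : -1 < k) x).1.neg)
    (by simpa only [Pi.mul_def, mul_assoc, IntegrableOn] using
      (integrableOn_rpow_mul_inv_exp_sub_add_one (by linarith : -1 < k - 1) x).const_mul k)
    h_zero (tendsto_rpow_mul_inv_exp_sub_add_one_atTop k x)
  simp only [mul_neg, integral_neg, mul_assoc, integral_const_mul] at h
  linarith

/-- For every `k > 0`, the complete Fermi-Dirac integral `F_k` is differentiable on `ℝ`
with derivative `F_{k-1}`. -/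
theorem fermiDiracF_hasDerivAt (k : ℝ) (hk : 0 < k) (x : ℝ) :
    HasDerivAt (fermiDiracF k) (fermiDiracF (k - 1) x) x := by
  have h := (hasDerivAt_integral_fermiDirac (by linarith : -1 < k) x).2.const_mul
    (Gamma (k + 1))⁻¹
  rw [integral_rpow_mul_exp_sub_div_sq hk x] at h
  unfold fermiDiracF
  simp only [div_eq_mul_inv]
  refine h.congr_deriv ?_
  rw [sub_add_cancel, Gamma_add_one hk.ne']
  field_simp
end

section
/- (Exactness of the D2Q9 Fermi-Dirac cubature.) Fix β > 0 and μ ∈ ℝ, and set n = (2π/β) F_0(βμ), a = F_1(βμ)² / (9 F_0(βμ) F_2(βμ)), ξ = (3 F_2(βμ) / (β F_1(βμ)))^{1/2}. Define weights on the nine points ξ·(i₁,i₂), i₁,i₂ ∈ {−1,0,1}, by w_{(0,0)} = 1 − 5a, w_{(i₁,i₂)} = a when |i₁| + |i₂| = 1, and w_{(i₁,i₂)} = a/4 when |i₁| + |i₂| = 2. Then for all natural numbers m₁, m₂ with m₁ + m₂ ≤ 5, (1/n) ∫_{ℝ²} p₁^{m₁} p₂^{m₂} (exp(β(|p|²/2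 − μ)) + 1)^{−1} dp = Σ_{i₁,i₂ ∈ {−1,0,1}} w_{(i₁,i₂)} (ξ i₁)^{m₁} (ξ i₂)^{m₂}. -/
open MeasureTheory

theorem integrableOn_fermiDirac {k : ℝ} (hk : -1 < k) (x : ℝ) :
    IntegrableOn (fun y : ℝ => y ^ k / (Real.exp (y - x) + 1)) (Set.Ioi 0) := by
  have hdom : IntegrableOn (fun y : ℝ => Real.exp x * (Real.exp (-y) * y ^ (k + 1 - 1)))
      (Set.Ioi 0) :=
    (Real.GammaIntegral_convergent (by linarith : 0 < k + 1)).const_mul _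
  refine Integrable.mono' hdom (Measurable.aestronglyMeasurable (by fun_prop)) ?_
  refine (ae_restrict_iff' measurableSet_Ioi).mpr (ae_of_all _ fun y (hy : 0 < y) => ?_)
  rw [Real.norm_of_nonneg (by positivity), add_sub_cancel_right,
    show Real.exp x * (Real.exp (-y) * y ^ k) = y ^ k / Real.exp (y - x) by
      rw [Real.exp_sub, Real.exp_neg]; field_simp]
  gcongr
  linarith

theorem fermiDiracF_pos {k : ℝ} (hk : -1 < k) (x : ℝ) : 0 < fermiDiracF k x := by
  refine mul_pos (inv_pos.mpr (Real.Gamma_pos_of_pos (by linarith))) ?_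
  have hpos : ∀ y ∈ Set.Ioi (0 : ℝ), 0 < y ^ k / (Real.exp (y - x) + 1) := fun y hy => by
    have : (0 : ℝ) < y := hy
    positivity
  rw [setIntegral_pos_iff_support_of_nonneg_ae
    ((ae_restrict_iff' measurableSet_Ioi).mpr (ae_of_all _ fun y hy => (hpos y hy).le))
    (integrableOn_fermiDirac hk x),
    Set.inter_eq_right.mpr fun y hy => Function.mem_support.mpr (hpos y hy).ne', Real.volume_Ioi]
  exact ENNReal.zero_lt_top

theorem integral_radial_fermiDirac {β : ℝ} (hβ : 0 < β) (μ : ℝ) (j : ℕ) :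
    ∫ r in Set.Ioi (0 : ℝ), r ^ (2 * j + 1) * (Real.exp (β * (r ^ 2 / 2 - μ)) + 1)⁻¹
      = 2 ^ j * j.factorial / β ^ (j + 1) * fermiDiracF j (β * μ) := by
  set G : ℝ → ℝ := fun y => y ^ (j : ℝ) / (Real.exp (y - β * μ) + 1) with hG
  have hscale : ∫ u in Set.Ioi (0 : ℝ), G (β / 2 * u)
      = (β / 2)⁻¹ * ∫ y in Set.Ioi (0 : ℝ), G y := by
    have h := integral_comp_mul_left_Ioi G 0 (half_pos hβ)
    rwa [mul_zero, smul_eq_mul] at h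
  rw [← integral_comp_rpow_Ioi_of_pos (g := fun u => G (β / 2 * u)) two_pos] at hscale
  have hintegrand : ∫ r in Set.Ioi (0 : ℝ), (2 * r ^ ((2 : ℝ) - 1)) • G (β / 2 * r ^ (2 : ℝ))
      = ∫ r in Set.Ioi (0 : ℝ), (2 * (β / 2) ^ j) *
          (r ^ (2 * j + 1) * (Real.exp (β * (r ^ 2 / 2 - μ)) + 1)⁻¹) := by
    refine integral_congr_ae (ae_of_all _ fun r => ?_)
    have h1 : r ^ ((2 : ℝ) - 1) = r := by norm_num
    simp only [hG, h1, Real.rpow_two, Real.rpow_natCast, smul_eq_mul]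
    rw [show β / 2 * r ^ 2 - β * μ = β * (r ^ 2 / 2 - μ) by ring]
    ring
  rw [hintegrand, integral_const_mul] at hscale
  rw [fermiDiracF, Real.Gamma_nat_eq_factorial]
  have hfac : (j.factorial : ℝ) ≠ 0 := by positivity
  generalize (∫ r in Set.Ioi (0 : ℝ),
    r ^ (2 * j + 1) * (Real.exp (β * (r ^ 2 / 2 - μ)) + 1)⁻¹) = I at hscale ⊢
  change I = _ * (_ * ∫ y in Set.Ioi (0 : ℝ), G y)
  generalize (∫ y in Set.Ioi (0 : ℝ), G y) = K at hscale ⊢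
  rw [div_pow] at hscale
  field_simp at hscale ⊢
  linear_combination hscale

theorem integral_monomial_mul_radial (g : ℝ → ℝ) (m l : ℕ) :
    ∫ p : EuclideanSpace ℝ (Fin 2), (p 0) ^ m * (p 1) ^ l * g (‖p‖ ^ 2)
      = (∫ r in Set.Ioi (0 : ℝ), r ^ (m + l + 1) * g (r ^ 2)) *
        ∫ θ in (-Real.pi)..Real.pi, Real.sin θ ^ l * Real.cos θ ^ m := by
  have hprod : ∫ p : EuclideanSpace ℝ (Fin 2), (p 0) ^ m * (p 1) ^ l * g (‖p‖ ^ 2)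
      = ∫ q : ℝ × ℝ, q.1 ^ m * q.2 ^ l * g (q.1 ^ 2 + q.2 ^ 2) := by
    rw [← (PiLp.volume_preserving_toLp (Fin 2)).integral_comp
        (MeasurableEquiv.toLp 2 _).measurableEmbedding,
      ← (volume_preserving_finTwoArrow ℝ).integral_comp']
    simp [EuclideanSpace.real_norm_sq_eq, Fin.sum_univ_two, MeasurableEquiv.finTwoArrow]
  have hpi : -Real.pi ≤ Real.pi := by linarith [Real.pi_pos]
  rw [hprod, ← integral_comp_polarCoord_symm, intervalIntegral.integral_of_le hpi,
    integral_Ioc_eq_integral_Ioo, ← setIntegral_prod_mul, polarCoord_target]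
  refine integral_congr_ae (ae_of_all _ fun q => ?_)
  simp only [polarCoord_symm_apply, smul_eq_mul]
  rw [show (q.1 * Real.cos q.2) ^ 2 + (q.1 * Real.sin q.2) ^ 2 = q.1 ^ 2 by
    linear_combination q.1 ^ 2 * Real.sin_sq_add_cos_sq q.2]
  ring

theorem integral_sin_pow_mul_cos_pow_eq_zero_of_odd {m l : ℕ} (h : Odd m ∨ Odd l) :
    ∫ θ in (-Real.pi)..Real.pi, Real.sin θ ^ l * Real.cos θ ^ m = 0 := by
  rcases h with ⟨k, rfl⟩ | ⟨k, rfl⟩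
  · rw [integral_sin_pow_mul_cos_pow_odd]
    simp
  · rw [integral_sin_pow_odd_mul_cos_pow]
    simp

theorem integral_fermiDirac_moment {β : ℝ} (hβ : 0 < β) (μ : ℝ) {m l j : ℕ} (h : m + l = 2 * j) :
    ∫ p : EuclideanSpace ℝ (Fin 2),
        (p 0) ^ m * (p 1) ^ l * (Real.exp (β * (‖p‖ ^ 2 / 2 - μ)) + 1)⁻¹
      = 2 ^ j * j.factorial / β ^ (j + 1) * fermiDiracF j (β * μ) *
        ∫ θ in (-Real.pi)..Real.pi, Real.sin θ ^ l * Real.cos θ ^ m := by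
  rw [integral_monomial_mul_radial (fun t => (Real.exp (β * (t / 2 - μ)) + 1)⁻¹), h,
    integral_radial_fermiDirac hβ]

theorem integral_fermiDirac_moment_eq_zero_of_odd (β μ : ℝ) {m l : ℕ} (h : Odd m ∨ Odd l) :
    ∫ p : EuclideanSpace ℝ (Fin 2),
        (p 0) ^ m * (p 1) ^ l * (Real.exp (β * (‖p‖ ^ 2 / 2 - μ)) + 1)⁻¹ = 0 := by
  rw [integral_monomial_mul_radial (fun t => (Real.exp (β * (t / 2 - μ)) + 1)⁻¹),
    integral_sin_pow_mul_cos_pow_eq_zero_of_odd h, mul_zero]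

theorem d2q9_sum_eq (w : ℤ → ℤ → ℝ) (a ξ : ℝ)
    (hw : ∀ i₁ i₂ : ℤ, w i₁ i₂ =
      if |i₁| + |i₂| = 0 then 1 - 5 * a
      else if |i₁| + |i₂| = 1 then a
      else a / 4) (m l : ℕ) :
    ∑ i₁ ∈ ({-1, 0, 1} : Finset ℤ), ∑ i₂ ∈ ({-1, 0, 1} : Finset ℤ),
        w i₁ i₂ * (ξ * (i₁ : ℝ)) ^ m * (ξ * (i₂ : ℝ)) ^ l
      = (1 - 5 * a) * 0 ^ m * 0 ^ l + a * (ξ ^ m + (-ξ) ^ m) * 0 ^ l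
        + a * 0 ^ m * (ξ ^ l + (-ξ) ^ l)
        + a / 4 * (ξ ^ m + (-ξ) ^ m) * (ξ ^ l + (-ξ) ^ l) := by
  simp [hw]
  ring

/-- Exactness of the D2Q9 Fermi-Dirac cubature: with the weights
`w₀₀ = 1 - 5a`, `w₀₁ = a`, `w₁₁ = a/4` on the nine points `ξ·(i₁,i₂)`,
`i₁,i₂ ∈ {-1,0,1}`, the cubature reproduces all normalized Fermi-Dirac moments of
total degree at most 5. -/
theorem d2q9_cubature_exact (β μ : ℝ) (hβ : 0 < β)
    (n a ξ : ℝ)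
    (hn : n = (2 * Real.pi / β) * fermiDiracF 0 (β * μ))
    (ha : a = fermiDiracF 1 (β * μ) ^ 2 / (9 * fermiDiracF 0 (β * μ) * fermiDiracF 2 (β * μ)))
    (hξ : ξ = Real.sqrt (3 * fermiDiracF 2 (β * μ) / (β * fermiDiracF 1 (β * μ))))
    (w : ℤ → ℤ → ℝ)
    (hw : ∀ i₁ i₂ : ℤ, w i₁ i₂ =
      if |i₁| + |i₂| = 0 then 1 - 5 * a
      else if |i₁| + |i₂| = 1 then a
      else a / 4)
    (m₁ m₂ : ℕ) (hm : m₁ + m₂ ≤ 5) :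
    (1 / n) * ∫ p : EuclideanSpace ℝ (Fin 2),
        (p 0) ^ m₁ * (p 1) ^ m₂ * (Real.exp (β * (‖p‖ ^ 2 / 2 - μ)) + 1)⁻¹
      = ∑ i₁ ∈ ({-1, 0, 1} : Finset ℤ), ∑ i₂ ∈ ({-1, 0, 1} : Finset ℤ),
          w i₁ i₂ * (ξ * (i₁ : ℝ)) ^ m₁ * (ξ * (i₂ : ℝ)) ^ m₂ := by
  have hF0 := fermiDiracF_pos (k := 0) (by norm_num) (β * μ)
  have hF1 := fermiDiracF_pos (k := 1) (by norm_num) (β * μ)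
  have hF2 := fermiDiracF_pos (k := 2) (by norm_num) (β * μ)
  have hpi := Real.pi_pos
  have hsin : Real.sin (4 * Real.pi) = 0 := mod_cast Real.sin_nat_mul_pi 4
  rw [d2q9_sum_eq w a ξ hw]
  by_cases hodd : Odd m₁ ∨ Odd m₂
  · rw [integral_fermiDirac_moment_eq_zero_of_odd β μ hodd, mul_zero]
    rcases hodd with h | h <;> simp [h.neg_pow, h.pos.ne']
  have hξ2 : ξ ^ 2 = 3 * fermiDiracF 2 (β * μ) / (β * fermiDiracF 1 (β * μ)) := by
    rw [hξ, Real.sq_sqrt (by positivity)]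
  have hξ4 : ξ ^ 4 = (3 * fermiDiracF 2 (β * μ) / (β * fermiDiracF 1 (β * μ))) ^ 2 := by
    rw [← hξ2]; ring
  simp only [not_or, Nat.not_odd_iff_even] at hodd
  obtain ⟨⟨i, rfl⟩, k, rfl⟩ := hodd
  rw [integral_fermiDirac_moment hβ μ (j := i + k) (by ring)]
  have hi : i ≤ 2 := by omega
  have hk : k ≤ 2 - i := by omega
  interval_cases i <;> interval_cases k <;>
    norm_num [integral_sin_pow, integral_cos_pow, integral_sin_sq_mul_cos_sq, Nat.factorial,
      even_two.neg_pow, (show Even 4 by decide).neg_pow, hξ2, hξ4, hn, ha, hsin]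
  all_goals field_simp
  all_goals ring
end

section
/- (Exactness of the D3Q19 Fermi-Dirac cubature.) Fix β > 0 and μ ∈ ℝ, and set n = (2π/β)^{3/2} F_{1/2}(βμ), a = F_{3/2}(βμ)² / (18 F_{1/2}(βμ) F_{5/2}(βμ)), ξ = (3 F_{5/2}(βμ) / (β F_{3/2}(βμ)))^{1/2}. On the 19 points ξ·(i₁,i₂,i₃) with i₁,i₂,i₃ ∈ {−1,0,1} and |i₁| + |i₂| + |i₃| ≤ 2, define weights w_{(0,0,0)} = 1 − 12a, w = a for points with exactly one nonzero coordinate, and w = a/2 for points with exactly two nonzero coordinates. Then for all natural numbers m₁, m₂, m₃ with m₁ + m₂ + m₃ ≤ 5, (1/n) ∫_{ℝ³} p₁^{m₁} p₂^{m₂} p₃^{m₃} (exp(β(|p|²/2 − μ)) + 1)^{−1} dp = Σ w_{(i₁,i₂,i₃)} (ξ i₁)^{m₁} (ξ i₂)^{m₂} (ξ i₃)^{m₃}, the sum running over the 19 listed index triples. -/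
open MeasureTheory

open Set Metric in
/-- Polar coordinates for a homogeneous function times a radial function. -/
theorem integral_homogeneous_mul_fun_norm {E : Type*} [NormedAddCommGroup E] [NormedSpace ℝ E]
    [FiniteDimensional ℝ E] [Nontrivial E] [MeasurableSpace E] [BorelSpace E]
    (ν : Measure E) [ν.IsAddHaarMeasure] {P : E → ℝ} {d : ℕ}
    (hP : ∀ r : ℝ, 0 < r → ∀ x, P (r • x) = r ^ d * P x) (f : ℝ → ℝ) :
    ∫ x, P x * f ‖x‖ ∂ν = (∫ u : sphere (0 : E) 1, P u ∂ν.toSphere) *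
      ∫ r in Ioi (0 : ℝ), r ^ (Module.finrank ℝ E - 1 + d) * f r := by
  calc
    ∫ x, P x * f ‖x‖ ∂ν = ∫ x : ({(0)}ᶜ : Set E), P x.1 * f ‖x.1‖ ∂(ν.comap (↑)) := by
      rw [integral_subtype_comap (measurableSet_singleton _).compl fun x ↦ P x * f ‖x‖,
        restrict_compl_singleton]
    _ = ∫ x, P x.1 * ((x.2 : ℝ) ^ d * f x.2)
          ∂ν.toSphere.prod (.volumeIoiPow (Module.finrank ℝ E - 1)) := by
      rw [← ν.measurePreserving_homeomorphUnitSphereProd.integral_comp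
        (Homeomorph.measurableEmbedding _)]
      refine integral_congr_ae (.of_forall fun x ↦ ?_)
      have hx : 0 < ‖(x : E)‖ := norm_pos_iff.2 x.2
      have h := hP ‖(x : E)‖ hx (‖(x : E)‖⁻¹ • (x : E))
      rw [smul_inv_smul₀ hx.ne'] at h
      simp only [homeomorphUnitSphereProd_apply_fst_coe, homeomorphUnitSphereProd_apply_snd_coe]
      rw [h]
      ring
    _ = (∫ u : sphere (0 : E) 1, P u ∂ν.toSphere) *
          ∫ r : Ioi (0 : ℝ), (r : ℝ) ^ d * f r ∂.volumeIoiPow (Module.finrank ℝ E - 1) :=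
      integral_prod_mul (fun u : sphere (0 : E) 1 ↦ P u) fun r : Ioi (0 : ℝ) ↦ (r : ℝ) ^ d * f r
    _ = _ := by
      congr 1
      simp only [Measure.volumeIoiPow, ENNReal.ofReal]
      rw [integral_withDensity_eq_integral_smul,
        integral_subtype_comap measurableSet_Ioi fun a : ℝ ↦
          Real.toNNReal (a ^ (Module.finrank ℝ E - 1)) • (a ^ d * f a),
        setIntegral_congr_fun measurableSet_Ioi fun x hx ↦ ?_]
      · simp only [NNReal.smul_def, Real.coe_toNNReal _ (pow_nonneg (le_of_lt hx) _), smul_eq_mul]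
        ring
      · exact (measurable_subtype_coe.pow_const _).real_toNNReal

theorem integral_pow_mul_exp_neg_sq_Ioi (m : ℕ) :
    ∫ x in Set.Ioi (0 : ℝ), x ^ m * Real.exp (-x ^ 2) = Real.Gamma ((m + 1) / 2) / 2 := by
  have h := integral_rpow_mul_exp_neg_rpow (p := 2) (q := m) two_pos
    (by linarith [m.cast_nonneg (α := ℝ)])
  simp only [Real.rpow_natCast, Real.rpow_two] at h
  rw [h]
  ring

theorem integral_pow_mul_exp_neg_sq_of_odd {m : ℕ} (hm : Odd m) :
    ∫ x : ℝ, x ^ m * Real.exp (-x ^ 2) = 0 := by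
  have h := integral_neg_eq_self (fun x : ℝ ↦ x ^ m * Real.exp (-x ^ 2)) volume
  simp only [hm.neg_pow, even_two.neg_pow, neg_mul, integral_neg] at h
  linarith

theorem integral_pow_mul_exp_neg_sq_of_even {m : ℕ} (hm : Even m) :
    ∫ x : ℝ, x ^ m * Real.exp (-x ^ 2) = Real.Gamma ((m + 1) / 2) := by
  have h := integral_comp_abs (f := fun x : ℝ ↦ x ^ m * Real.exp (-x ^ 2))
  simp only [hm.pow_abs, even_two.pow_abs] at h
  rw [h, integral_pow_mul_exp_neg_sq_Ioi]
  ring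

/-- Monomial moments of a radial function on `ℝ^ι`, expressed through Gaussian moments. -/
theorem integral_monomial_mul_fun_norm {ι : Type*} [Fintype ι] [Nonempty ι] (m : ι → ℕ)
    (f : ℝ → ℝ) :
    (∫ p : EuclideanSpace ℝ ι, (∏ i, p i ^ m i) * f ‖p‖) *
        (Real.Gamma ((∑ i, m i + Fintype.card ι : ℕ) / 2) / 2) =
      (∏ i, ∫ x : ℝ, x ^ m i * Real.exp (-x ^ 2)) *
        ∫ r in Set.Ioi (0 : ℝ), r ^ (Fintype.card ι - 1 + ∑ i, m i) * f r := by
  have hP : ∀ r : ℝ, 0 < r → ∀ x : EuclideanSpace ℝ ι,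
      ∏ i, (r • x) i ^ m i = r ^ (∑ i, m i) * ∏ i, x i ^ m i := fun r _ x ↦ by
    simp only [PiLp.smul_apply, smul_eq_mul, mul_pow, Finset.prod_mul_distrib,
      Finset.prod_pow_eq_pow_sum]
  have hgauss : ∫ p : EuclideanSpace ℝ ι, (∏ i, p i ^ m i) * Real.exp (-‖p‖ ^ 2) =
      ∏ i, ∫ x : ℝ, x ^ m i * Real.exp (-x ^ 2) := by
    rw [← integral_fintype_prod_volume_eq_prod,
      ← (PiLp.volume_preserving_toLp ι).integral_comp
        (MeasurableEquiv.toLp 2 (ι → ℝ)).measurableEmbedding]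
    simp only [EuclideanSpace.norm_sq_eq, Real.norm_eq_abs, sq_abs, ← Finset.sum_neg_distrib,
      Real.exp_sum, Finset.prod_mul_distrib]
  have h₁ := integral_homogeneous_mul_fun_norm volume
    (P := fun p : EuclideanSpace ℝ ι ↦ ∏ i, p i ^ m i) hP f
  have h₂ := integral_homogeneous_mul_fun_norm volume
    (P := fun p : EuclideanSpace ℝ ι ↦ ∏ i, p i ^ m i) hP fun r ↦ Real.exp (-r ^ 2)
  rw [finrank_euclideanSpace] at h₁ h₂
  rw [hgauss, integral_pow_mul_exp_neg_sq_Ioi] at h₂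
  have hc : ((Fintype.card ι - 1 + ∑ i, m i : ℕ) : ℝ) + 1 =
      (∑ i, m i + Fintype.card ι : ℕ) := by
    have := Fintype.card_pos (α := ι)
    exact_mod_cast (by lia : Fintype.card ι - 1 + ∑ i, m i + 1 = ∑ i, m i + Fintype.card ι)
  rw [hc] at h₂
  rw [h₁, h₂]
  ring

/-- Radial moments of the Fermi-Dirac distribution, via the substitution `y = β r² / 2`. -/
theorem integral_pow_mul_fermiDirac {β : ℝ} (hβ : 0 < β) (μ : ℝ) (d : ℕ) :
    ∫ r in Set.Ioi (0 : ℝ), r ^ d * (Real.exp (β * (r ^ 2 / 2 - μ)) + 1)⁻¹ =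
      Real.Gamma ((d + 1) / 2) / 2 * (2 / β) ^ (((d : ℝ) + 1) / 2) *
        fermiDiracF (((d : ℝ) - 1) / 2) (β * μ) := by
  set k : ℝ := ((d : ℝ) - 1) / 2 with hk
  have hk1 : ((d : ℝ) + 1) / 2 = k + 1 := by rw [hk]; ring
  have hd : (0 : ℝ) < k + 1 := by rw [← hk1]; positivity
  set b : ℝ := β / 2 with hb
  have hb0 : 0 < b := by positivity
  set g : ℝ → ℝ := fun y ↦ y ^ k / (Real.exp (y - β * μ) + 1) with hg
  have h₁ : ∫ y in Set.Ioi (0 : ℝ), g (b * y) = b⁻¹ * ∫ y in Set.Ioi (0 : ℝ), g y := by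
    simpa using integral_comp_mul_left_Ioi g 0 hb0
  have h₂ := integral_comp_rpow_Ioi_of_pos (g := fun y ↦ g (b * y)) (p := 2) two_pos
  have h₃ : ∀ r ∈ Set.Ioi (0 : ℝ), ((2 : ℝ) * r ^ ((2 : ℝ) - 1)) • g (b * r ^ (2 : ℝ)) =
      2 * b ^ k * (r ^ d * (Real.exp (β * (r ^ 2 / 2 - μ)) + 1)⁻¹) := fun r hr ↦ by
    have hr0 : (0 : ℝ) < r := hr
    have hpow : r ^ d = r * (r ^ 2) ^ k := by
      have hdk : (d : ℝ) = 1 + (2 : ℕ) * k := by rw [hk]; push_cast; ring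
      rw [← Real.rpow_natCast, ← Real.rpow_natCast r 2, ← Real.rpow_mul hr0.le, hdk,
        Real.rpow_add hr0, Real.rpow_one]
    have hexp : b * r ^ 2 - β * μ = β * (r ^ 2 / 2 - μ) := by rw [hb]; ring
    simp only [hg, smul_eq_mul, Real.rpow_two]
    rw [show (2 : ℝ) - 1 = 1 by norm_num, Real.rpow_one, Real.mul_rpow hb0.le (by positivity),
      hexp, hpow]
    ring
  rw [setIntegral_congr_fun measurableSet_Ioi h₃, integral_const_mul, h₁] at h₂
  have h₄ : ∫ y in Set.Ioi (0 : ℝ), g y = Real.Gamma (k + 1) * fermiDiracF k (β * μ) := by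
    rw [fermiDiracF, mul_inv_cancel_left₀ (Real.Gamma_pos_of_pos hd).ne']
  have hbk : (2 / β) ^ (k + 1) = (b ^ k * b)⁻¹ := by
    rw [← Real.rpow_add_one hb0.ne', ← Real.inv_rpow hb0.le, hb, inv_div]
  have hbk0 : b ^ k ≠ 0 := (Real.rpow_pos_of_pos hb0 k).ne'
  rw [h₄] at h₂
  rw [hk1, hbk]
  field_simp
  field_simp at h₂
  linarith

/-- Monomial moments of the Fermi-Dirac distribution on `ℝ³`. -/
theorem integral_monomial_mul_fermiDirac {β : ℝ} (hβ : 0 < β) (μ : ℝ) (m₁ m₂ m₃ : ℕ) :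
    ∫ p : EuclideanSpace ℝ (Fin 3),
        (p 0) ^ m₁ * (p 1) ^ m₂ * (p 2) ^ m₃ * (Real.exp (β * (‖p‖ ^ 2 / 2 - μ)) + 1)⁻¹ =
      (∫ x : ℝ, x ^ m₁ * Real.exp (-x ^ 2)) * (∫ x : ℝ, x ^ m₂ * Real.exp (-x ^ 2)) *
        (∫ x : ℝ, x ^ m₃ * Real.exp (-x ^ 2)) *
        ((2 / β) ^ (((m₁ + m₂ + m₃ : ℕ) + 3 : ℝ) / 2) *
          fermiDiracF (((m₁ + m₂ + m₃ : ℕ) + 1 : ℝ) / 2) (β * μ)) := by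
  have h := integral_monomial_mul_fun_norm ![m₁, m₂, m₃]
    fun r ↦ (Real.exp (β * (r ^ 2 / 2 - μ)) + 1)⁻¹
  rw [integral_pow_mul_fermiDirac hβ] at h
  simp only [Fin.prod_univ_three, Fin.sum_univ_three, Matrix.cons_val, Fintype.card_fin] at h
  set s := m₁ + m₂ + m₃
  have e₁ : (((3 - 1 + s : ℕ) : ℝ) + 1) / 2 = ((s : ℝ) + 3) / 2 := by push_cast; ring
  have e₂ : (((3 - 1 + s : ℕ) : ℝ) - 1) / 2 = ((s : ℝ) + 1) / 2 := by push_cast; ring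
  have e₃ : ((s + 3 : ℕ) : ℝ) / 2 = ((s : ℝ) + 3) / 2 := by push_cast; ring
  rw [e₁, e₂, e₃] at h
  have hΓ : Real.Gamma (((s : ℝ) + 3) / 2) / 2 ≠ 0 :=
    (half_pos (Real.Gamma_pos_of_pos (by positivity))).ne'
  refine mul_right_cancel₀ hΓ (h.trans ?_)
  ring

/-- Moments of a weight on the D3Q19 points that takes the values `c₀`, `c₁`, `c₂` on points with
zero, one and two nonzero coordinates. -/
theorem d3q19_sum (ξ c₀ c₁ c₂ : ℝ) (w : ℤ → ℤ → ℤ → ℝ)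
    (hw : ∀ i₁ i₂ i₃ : ℤ, w i₁ i₂ i₃ =
      if |i₁| + |i₂| + |i₃| = 0 then c₀
      else if |i₁| + |i₂| + |i₃| = 1 then c₁
      else c₂)
    (m₁ m₂ m₃ : ℕ) :
    ∑ i ∈ (({-1, 0, 1} : Finset ℤ) ×ˢ ({-1, 0, 1} : Finset ℤ) ×ˢ
            ({-1, 0, 1} : Finset ℤ)).filter
            (fun i => |i.1| + |i.2.1| + |i.2.2| ≤ 2),
          w i.1 i.2.1 i.2.2 * (ξ * (i.1 : ℝ)) ^ m₁ * (ξ * (i.2.1 : ℝ)) ^ m₂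
            * (ξ * (i.2.2 : ℝ)) ^ m₃ =
      ξ ^ (m₁ + m₂ + m₃) * (c₀ * (0 ^ m₁ * 0 ^ m₂ * 0 ^ m₃) +
        c₁ * ((1 + (-1) ^ m₁) * 0 ^ m₂ * 0 ^ m₃ + 0 ^ m₁ * (1 + (-1) ^ m₂) * 0 ^ m₃ +
          0 ^ m₁ * 0 ^ m₂ * (1 + (-1) ^ m₃)) +
        c₂ * ((1 + (-1) ^ m₁) * (1 + (-1) ^ m₂) * 0 ^ m₃ +
          (1 + (-1) ^ m₁) * 0 ^ m₂ * (1 + (-1) ^ m₃) +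
          0 ^ m₁ * (1 + (-1) ^ m₂) * (1 + (-1) ^ m₃))) := by
  simp only [hw, mul_pow]
  rw [Finset.sum_filter]
  simp [Finset.sum_product]
  ring

/-- Exactness of the D3Q19 Fermi-Dirac cubature: with the weights
`w₀₀₀ = 1 - 12a`, `w = a` for points with exactly one nonzero coordinate and
`w = a/2` for points with exactly two nonzero coordinates, on the 19 points
`ξ·(i₁,i₂,i₃)`, `i₁,i₂,i₃ ∈ {-1,0,1}`, `|i₁|+|i₂|+|i₃| ≤ 2`, the cubature
reproduces all normalized Fermi-Dirac moments of total degree at most 5. -/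
theorem d3q19_cubature_exact (β μ : ℝ) (hβ : 0 < β)
    (n a ξ : ℝ)
    (hn : n = (2 * Real.pi / β) ^ ((3:ℝ)/2) * fermiDiracF (1/2) (β * μ))
    (ha : a = fermiDiracF (3/2) (β * μ) ^ 2 /
        (18 * fermiDiracF (1/2) (β * μ) * fermiDiracF (5/2) (β * μ)))
    (hξ : ξ = Real.sqrt (3 * fermiDiracF (5/2) (β * μ) / (β * fermiDiracF (3/2) (β * μ))))
    (w : ℤ → ℤ → ℤ → ℝ)
    (hw : ∀ i₁ i₂ i₃ : ℤ, w i₁ i₂ i₃ =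
      if |i₁| + |i₂| + |i₃| = 0 then 1 - 12 * a
      else if |i₁| + |i₂| + |i₃| = 1 then a
      else a / 2)
    (m₁ m₂ m₃ : ℕ) (hm : m₁ + m₂ + m₃ ≤ 5) :
    (1 / n) * ∫ p : EuclideanSpace ℝ (Fin 3),
        (p 0) ^ m₁ * (p 1) ^ m₂ * (p 2) ^ m₃ * (Real.exp (β * (‖p‖ ^ 2 / 2 - μ)) + 1)⁻¹
      = ∑ i ∈ (({-1, 0, 1} : Finset ℤ) ×ˢ ({-1, 0, 1} : Finset ℤ) ×ˢ
            ({-1, 0, 1} : Finset ℤ)).filter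
            (fun i => |i.1| + |i.2.1| + |i.2.2| ≤ 2),
          w i.1 i.2.1 i.2.2 * (ξ * (i.1 : ℝ)) ^ m₁ * (ξ * (i.2.1 : ℝ)) ^ m₂
            * (ξ * (i.2.2 : ℝ)) ^ m₃ := by
  have hF₁ := fermiDiracF_pos (k := 1 / 2) (by norm_num) (β * μ)
  have hF₃ := fermiDiracF_pos (k := 3 / 2) (by norm_num) (β * μ)
  have hF₅ := fermiDiracF_pos (k := 5 / 2) (by norm_num) (β * μ)
  rw [integral_monomial_mul_fermiDirac hβ, d3q19_sum ξ _ _ _ w hw]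
  have odd_case {m : ℕ} (h : ¬Even m) :
      ∫ x : ℝ, x ^ m * Real.exp (-x ^ 2) = 0 ∧ (0 : ℝ) ^ m = 0 ∧ (1 + (-1) ^ m : ℝ) = 0 := by
    rw [Nat.not_even_iff_odd] at h
    exact ⟨integral_pow_mul_exp_neg_sq_of_odd h, zero_pow h.pos.ne', by simp [h.neg_one_pow]⟩
  by_cases h₁ : Even m₁
  swap
  · obtain ⟨hI, h0, h1⟩ := odd_case h₁
    rw [hI, h0, h1]
    ring
  by_cases h₂ : Even m₂
  swap
  · obtain ⟨hI, h0, h1⟩ := odd_case h₂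
    rw [hI, h0, h1]
    ring
  by_cases h₃ : Even m₃
  swap
  · obtain ⟨hI, h0, h1⟩ := odd_case h₃
    rw [hI, h0, h1]
    ring
  rw [integral_pow_mul_exp_neg_sq_of_even h₁, integral_pow_mul_exp_neg_sq_of_even h₂,
    integral_pow_mul_exp_neg_sq_of_even h₃, h₁.neg_one_pow, h₂.neg_one_pow, h₃.neg_one_pow]
  obtain ⟨k₁, rfl⟩ := even_iff_exists_two_mul.1 h₁
  obtain ⟨k₂, rfl⟩ := even_iff_exists_two_mul.1 h₂
  obtain ⟨k₃, rfl⟩ := even_iff_exists_two_mul.1 h₃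
  have hξ2 : ξ ^ 2 = 3 * fermiDiracF (5/2) (β * μ) / (β * fermiDiracF (3/2) (β * μ)) := by
    rw [hξ, Real.sq_sqrt (by positivity)]
  have hξk (k : ℕ) : ξ ^ (2 * k) =
      (3 * fermiDiracF (5/2) (β * μ) / (β * fermiDiracF (3/2) (β * μ))) ^ k := by
    rw [pow_mul, hξ2]
  have hn' : n = (2 / β) ^ ((3 : ℝ) / 2) * √Real.pi ^ 3 * fermiDiracF (1 / 2) (β * μ) := by
    rw [hn, mul_div_right_comm, Real.mul_rpow (by positivity) Real.pi_pos.le,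
      Real.rpow_div_two_eq_sqrt 3 Real.pi_pos.le]
    norm_cast
  have hβs : ((2 / β) ^ (((2 * k₁ + 2 * k₂ + 2 * k₃ : ℕ) + 3 : ℝ) / 2) : ℝ) =
      (2 / β) ^ ((3 : ℝ) / 2) * (2 / β) ^ (k₁ + k₂ + k₃) := by
    rw [← Real.rpow_add_natCast (by positivity)]
    congr 1
    push_cast
    ring
  have hΓ₁ : Real.Gamma (1 / 2) = √Real.pi := Real.Gamma_one_half_eq
  have hΓ₃ : Real.Gamma (3 / 2) = √Real.pi / 2 := by
    rw [show (3 / 2 : ℝ) = 1 / 2 + 1 by norm_num, Real.Gamma_add_one (by norm_num), hΓ₁]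
    ring
  have hΓ₅ : Real.Gamma (5 / 2) = 3 * √Real.pi / 4 := by
    rw [show (5 / 2 : ℝ) = 3 / 2 + 1 by norm_num, Real.Gamma_add_one (by norm_num), hΓ₃]
    ring
  have hπ : 0 < √Real.pi := Real.sqrt_pos.2 Real.pi_pos
  have hB : 0 < (2 / β) ^ ((3 : ℝ) / 2) := by positivity
  rw [hβs, hn', ← mul_add, ← mul_add, hξk, ha]
  clear hβs hn' hn ha hξ hξ2 hξk hw h₁ h₂ h₃
  generalize (2 / β) ^ ((3 : ℝ) / 2) = B at *
  have hk₁ : k₁ ≤ 2 := by lia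
  have hk₂ : k₂ ≤ 2 := by lia
  have hk₃ : k₃ ≤ 2 := by lia
  interval_cases k₁ <;> interval_cases k₂ <;> interval_cases k₃ <;> first
    | lia
    | norm_num [hΓ₁, hΓ₃, hΓ₅]
      field_simp
      ring
end

section
/- (Pointwise non-negativity of the BGK entropy-production integrand.) Let W, V ∈ ℂ^{2×2} be Hermitian matrices all of whose eigenvalues lie in the open interval (0,1), and let h'(x) = log(1−x) − log(x) act on Hermitian matrices through continuous functional calculus. Then tr[(h'(W) − h'(V))(V − W)] ≥ 0, with equality if and only if W = V. -/
open Matrix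
open scoped ComplexOrder

/-- Functional calculus for Hermitian matrices: apply the real function `f` to the
eigenvalues in an orthonormal eigenbasis (and return `0` on non-Hermitian input). -/
noncomputable def matFun {n : ℕ} (f : ℝ → ℝ) (A : Matrix (Fin n) (Fin n) ℂ) :
    Matrix (Fin n) (Fin n) ℂ :=
  if hA : A.IsHermitian then
    (hA.eigenvectorUnitary : Matrix (Fin n) (Fin n) ℂ) *
      Matrix.diagonal (fun i => (f (hA.eigenvalues i) : ℂ)) *
      star (hA.eigenvectorUnitary : Matrix (Fin n) (Fin n) ℂ)
  else 0

/-- The matrix of overlaps between the eigenbases of two Hermitian matrices. -/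
noncomputable def eigenOverlap {n : ℕ} {A B : Matrix (Fin n) (Fin n) ℂ}
    (hA : A.IsHermitian) (hB : B.IsHermitian) : Matrix (Fin n) (Fin n) ℂ :=
  star (hA.eigenvectorUnitary : Matrix (Fin n) (Fin n) ℂ) *
    (hB.eigenvectorUnitary : Matrix (Fin n) (Fin n) ℂ)

section matFun

variable {n : ℕ} {A B : Matrix (Fin n) (Fin n) ℂ}

theorem matFun_eq (hA : A.IsHermitian) (f : ℝ → ℝ) :
    matFun f A = (hA.eigenvectorUnitary : Matrix (Fin n) (Fin n) ℂ) *
      Matrix.diagonal (fun i => (f (hA.eigenvalues i) : ℂ)) *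
      star (hA.eigenvectorUnitary : Matrix (Fin n) (Fin n) ℂ) :=
  dif_pos hA

theorem matFun_id (hA : A.IsHermitian) : matFun id A = A := by
  rw [matFun_eq hA]
  conv_rhs => rw [hA.spectral_theorem, Unitary.conjStarAlgAut_apply]
  rfl

theorem matFun_one (hA : A.IsHermitian) : matFun 1 A = 1 := by
  simp [matFun_eq hA]

theorem matFun_mul (hA : A.IsHermitian) (f g : ℝ → ℝ) :
    matFun f A * matFun g A = matFun (f * g) A := by
  have hU : star (hA.eigenvectorUnitary : Matrix (Fin n) (Fin n) ℂ) *
      (hA.eigenvectorUnitary : Matrix (Fin n) (Fin n) ℂ) = 1 := Unitary.coe_star_mul_self _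
  simp only [matFun_eq hA]
  generalize (hA.eigenvectorUnitary : Matrix (Fin n) (Fin n) ℂ) = U at hU ⊢
  rw [show ∀ D E : Matrix (Fin n) (Fin n) ℂ,
    U * D * star U * (U * E * star U) = U * (D * (star U * U) * E) * star U by
      intros; simp only [mul_assoc], hU, mul_one, diagonal_mul_diagonal]
  simp

theorem trace_matFun_mul_matFun (hA : A.IsHermitian) (hB : B.IsHermitian) (f g : ℝ → ℝ) :
    (matFun f A * matFun g B).trace =
      ((∑ i, ∑ j, f (hA.eigenvalues i) * g (hB.eigenvalues j) *
        Complex.normSq (eigenOverlap hA hB i j) : ℝ) : ℂ) := by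
  set P := eigenOverlap hA hB with hP
  have hPs : star P = star (hB.eigenvectorUnitary : Matrix (Fin n) (Fin n) ℂ) *
      (hA.eigenvectorUnitary : Matrix (Fin n) (Fin n) ℂ) := by
    rw [hP, eigenOverlap, star_mul, star_star]
  have key : (matFun f A * matFun g B).trace =
      (diagonal (fun i => (f (hA.eigenvalues i) : ℂ)) * P *
        (diagonal (fun i => (g (hB.eigenvalues i) : ℂ)) * star P)).trace := by
    rw [hPs, hP, eigenOverlap, matFun_eq hA, matFun_eq hB, mul_assoc, mul_assoc, trace_mul_comm]
    simp only [mul_assoc]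
  rw [key, trace]
  push_cast
  refine Finset.sum_congr rfl fun i _ => ?_
  rw [diag_apply, mul_apply]
  refine Finset.sum_congr rfl fun j _ => ?_
  rw [diagonal_mul, diagonal_mul, star_apply, Complex.normSq_eq_conj_mul_self, starRingEnd_apply]
  ring

theorem trace_matFun_sub_mul_sub (hA : A.IsHermitian) (hB : B.IsHermitian) (f : ℝ → ℝ) :
    ((matFun f A - matFun f B) * (B - A)).trace =
      ((∑ i, ∑ j, (f (hA.eigenvalues i) - f (hB.eigenvalues j)) *
        (hB.eigenvalues j - hA.eigenvalues i) *
        Complex.normSq (eigenOverlap hA hB i j) : ℝ) : ℂ) := by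
  have hAA : matFun f A * A = matFun (f * id) A * matFun 1 B := by
    rw [matFun_one hB, mul_one, ← matFun_mul hA, matFun_id hA]
  have hBB : matFun f B * B = matFun 1 A * matFun (f * id) B := by
    rw [matFun_one hA, one_mul, ← matFun_mul hB, matFun_id hB]
  have hAB : (matFun f A * B).trace = (matFun f A * matFun id B).trace := by rw [matFun_id hB]
  have hBA : (matFun f B * A).trace = (matFun id A * matFun f B).trace := by
    rw [matFun_id hA, trace_mul_comm]
  rw [sub_mul, mul_sub, mul_sub, trace_sub, trace_sub, trace_sub, hAA, hBB, hAB, hBA]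
  simp only [trace_matFun_mul_matFun hA hB, ← Complex.ofReal_sub, ← Finset.sum_sub_distrib]
  congr 1
  refine Finset.sum_congr rfl fun i _ => Finset.sum_congr rfl fun j _ => ?_
  simp only [Pi.mul_apply, Pi.one_apply, id]
  ring

theorem eq_of_eigenOverlap_eq_zero_or (hA : A.IsHermitian) (hB : B.IsHermitian)
    (h : ∀ i j, eigenOverlap hA hB i j = 0 ∨ hA.eigenvalues i = hB.eigenvalues j) : A = B := by
  have hcomm : diagonal (fun i => (hA.eigenvalues i : ℂ)) * eigenOverlap hA hB =
      eigenOverlap hA hB * diagonal (fun i => (hB.eigenvalues i : ℂ)) := by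
    ext i j
    rw [diagonal_mul, mul_diagonal]
    rcases h i j with h | h
    · simp [h]
    · rw [h, mul_comm]
  have hU : (hA.eigenvectorUnitary : Matrix (Fin n) (Fin n) ℂ) *
      star (hA.eigenvectorUnitary : Matrix (Fin n) (Fin n) ℂ) = 1 := Unitary.coe_mul_star_self _
  have hT : (hB.eigenvectorUnitary : Matrix (Fin n) (Fin n) ℂ) *
      star (hB.eigenvectorUnitary : Matrix (Fin n) (Fin n) ℂ) = 1 := Unitary.coe_mul_star_self _
  rw [← matFun_id hA, ← matFun_id hB, matFun_eq hA, matFun_eq hB]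
  unfold eigenOverlap at hcomm
  simp only [id]
  generalize (hA.eigenvectorUnitary : Matrix (Fin n) (Fin n) ℂ) = U at *
  generalize (hB.eigenvectorUnitary : Matrix (Fin n) (Fin n) ℂ) = T at *
  generalize diagonal (fun i => (hA.eigenvalues i : ℂ)) = D at *
  generalize diagonal (fun i => (hB.eigenvalues i : ℂ)) = E at *
  calc U * D * star U = U * (D * (star U * T)) * star T := by
        simp only [mul_assoc, hT, mul_one]
    _ = (U * star U) * T * E * star T := by rw [hcomm]; simp only [mul_assoc]
    _ = T * E * star T := by rw [hU, one_mul]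

/-- Applying a strictly decreasing function to Hermitian matrices is a strictly decreasing
operation with respect to the trace pairing. -/
theorem trace_matFun_sub_mul_sub_nonneg_and_eq_zero_iff (hA : A.IsHermitian) (hB : B.IsHermitian)
    {f : ℝ → ℝ} {s : Set ℝ} (hf : StrictAntiOn f s) (hAs : ∀ i, hA.eigenvalues i ∈ s)
    (hBs : ∀ i, hB.eigenvalues i ∈ s) :
    0 ≤ ((matFun f A - matFun f B) * (B - A)).trace ∧
      (((matFun f A - matFun f B) * (B - A)).trace = 0 ↔ A = B) := by
  have hpos : ∀ x ∈ s, ∀ y ∈ s, x ≠ y → 0 < (f x - f y) * (y - x) := by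
    intro x hx y hy hxy
    rcases lt_or_gt_of_ne hxy with h | h
    · exact mul_pos (sub_pos.2 (hf hx hy h)) (sub_pos.2 h)
    · exact mul_pos_of_neg_of_neg (sub_neg.2 (hf hy hx h)) (sub_neg.2 h)
  have hnn : ∀ i j, 0 ≤ (f (hA.eigenvalues i) - f (hB.eigenvalues j)) *
      (hB.eigenvalues j - hA.eigenvalues i) * Complex.normSq (eigenOverlap hA hB i j) := by
    intro i j
    refine mul_nonneg ?_ (Complex.normSq_nonneg _)
    by_cases h : hA.eigenvalues i = hB.eigenvalues j
    · simp [h]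
    · exact (hpos _ (hAs i) _ (hBs j) h).le
  refine ⟨?_, fun h => ?_, fun h => by simp [h]⟩
  · rw [trace_matFun_sub_mul_sub hA hB]
    exact Complex.zero_le_real.2 (Finset.sum_nonneg fun i _ => Finset.sum_nonneg fun j _ => hnn i j)
  · rw [trace_matFun_sub_mul_sub hA hB, Complex.ofReal_eq_zero,
      Finset.sum_eq_zero_iff_of_nonneg fun i _ => Finset.sum_nonneg fun j _ => hnn i j] at h
    refine eq_of_eigenOverlap_eq_zero_or hA hB fun i j => ?_
    have hij := (Finset.sum_eq_zero_iff_of_nonneg fun j _ => hnn i j).1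
      (h i (Finset.mem_univ i)) j (Finset.mem_univ j)
    by_contra! hne
    exact (mul_pos (hpos _ (hAs i) _ (hBs j) hne.2) (Complex.normSq_pos.2 hne.1)).ne' hij

end matFun

theorem strictAntiOn_log_one_sub_sub_log :
    StrictAntiOn (fun x : ℝ => Real.log (1 - x) - Real.log x) (Set.Ioo 0 1) := by
  intro x hx y hy hxy
  have h1 := Real.log_lt_log hx.1 hxy
  have h2 := Real.log_lt_log (sub_pos.2 hy.2) (sub_lt_sub_left hxy 1)
  exact sub_lt_sub h2 h1

/-- Pointwise non-negativity of the BGK entropy-production integrand: for Hermitian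
`2×2` matrices `W, V` with eigenvalues in `(0,1)`, and `h'(x) = log(1-x) - log x`
acting through the functional calculus, `tr[(h'(W) - h'(V))(V - W)] ≥ 0`, with
equality iff `W = V`. -/
theorem bgk_integrand_nonneg
    (W V : Matrix (Fin 2) (Fin 2) ℂ) (hW : W.IsHermitian) (hV : V.IsHermitian)
    (hWev : ∀ i, hW.eigenvalues i ∈ Set.Ioo (0:ℝ) 1)
    (hVev : ∀ i, hV.eigenvalues i ∈ Set.Ioo (0:ℝ) 1)
    (h' : ℝ → ℝ) (hh' : ∀ x : ℝ, h' x = Real.log (1 - x) - Real.log x) :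
    0 ≤ ((matFun h' W - matFun h' V) * (V - W)).trace ∧
    (((matFun h' W - matFun h' V) * (V - W)).trace = 0 ↔ W = V) := by
  obtain rfl : h' = fun x => Real.log (1 - x) - Real.log x := funext hh'
  exact trace_matFun_sub_mul_sub_nonneg_and_eq_zero_iff hW hV strictAntiOn_log_one_sub_sub_log
    hWev hVev
end

section
/- (Moment exactness of the 2D polynomial equilibrium ansatz.) Fix β₀ > 0, ε ∈ ℝ, u ∈ ℝ², and a Hermitian matrix ρ ∈ ℂ^{2×2}. Let n₀ = (2π/β₀) log 2, α_fac = 72 log 2 / (216 log 2 · ζ(3) − π⁴), α₁ = α_fac (3 ζ(3) − (π²/6) β₀ ε), α₂ = α_fac (2 log 2 · β₀ ε − π²/6), α₃ = 12 log 2 / π², α₄ = α_fac log 2, α₅ = −α_fac π²/6, and define W_eq(p) = (1/n₀)(exp(β₀ |p|²/2) + 1)^{−1} ρ (α₁ + α₂ β₀ |p|²/2 + α₃ β₀ (p·u) + α₄ (β₀ p·u)² + α₅ β₀ |u|²/2) for p ∈ ℝ². Then ∫_{ℝ²} W_eq(p) dp = ρ, ∫_{ℝ²} p tr[W_eq(p)]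 dp = tr[ρ] u, and ∫_{ℝ²} (|p|²/2) tr[W_eq(p)] dp = tr[ρ] (ε + |u|²/2). -/
open MeasureTheory Matrix
open scoped RealInnerProductSpace

lemma integral_fermi_zero :
    ∫ x in Set.Ioi (0 : ℝ), (Real.exp x + 1)⁻¹ = Real.log 2 := by
  have hderiv : ∀ x ∈ Set.Ici (0 : ℝ),
      HasDerivAt (fun x => -Real.log (1 + Real.exp (-x))) (Real.exp x + 1)⁻¹ x := by
    intro x _
    have h := (((hasDerivAt_neg x).exp.const_add 1).log (by positivity)).neg
    convert! h using 1
    rw [Real.exp_neg]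
    have := Real.exp_pos x
    field_simp
  have hlim : Filter.Tendsto (fun x => -Real.log (1 + Real.exp (-x))) Filter.atTop (nhds 0) := by
    have h := ((Real.tendsto_exp_neg_atTop_nhds_zero.const_add 1).log (by norm_num)).neg
    simpa using h
  rw [integral_Ioi_of_hasDerivAt_of_nonneg' hderiv (fun x _ => by positivity) hlim]
  norm_num

lemma hasSum_fermi {t : ℝ} (ht : 0 < t) :
    HasSum (fun n : ℕ => (-1 : ℝ) ^ n * Real.exp (-(n + 1) * t)) (Real.exp t + 1)⁻¹ := by
  have h := (hasSum_geometric_of_abs_lt_one (r := -Real.exp (-t))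
    (by rw [abs_neg, Real.abs_exp]; exact Real.exp_lt_one_iff.2 (by linarith))).mul_left (Real.exp (-t))
  convert! h using 1
  · ext n
    rw [neg_pow (Real.exp (-t)), ← Real.exp_nat_mul, mul_left_comm, ← Real.exp_add]
    ring_nf
  · rw [Real.exp_neg]
    have := Real.exp_pos t
    have h1 : 1 - -(Real.exp t)⁻¹ = (Real.exp t + 1) / Real.exp t := by
      field_simp
      ring
    rw [h1]
    field_simp

lemma hasSum_dirichlet_eta {k : ℕ} (hk : 1 < k) {z : ℝ}
    (hz : HasSum (fun n : ℕ => 1 / (n : ℝ) ^ k) z) :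
    HasSum (fun n : ℕ => (-1 : ℝ) ^ n / (n + 1 : ℝ) ^ k) ((1 - 2 / 2 ^ k) * z) := by
  have hk0 : k ≠ 0 := by omega
  have heven : HasSum (fun n : ℕ => (1 + (-1 : ℝ) ^ n) / (n : ℝ) ^ k) (2 / 2 ^ k * z) := by
    rw [← (mul_right_injective₀ (two_ne_zero' ℕ)).hasSum_iff]
    · convert! hz.mul_left (2 / 2 ^ k) using 2 with n
      simp [pow_mul, mul_pow]
      ring
    · intro n hn
      have : Odd n := by
        rw [← Nat.not_even_iff_odd]
        rintro ⟨m, rfl⟩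
        exact hn ⟨m, by simp; ring⟩
      simp [this.neg_one_pow]
  have h := (hasSum_nat_add_iff' 1).2 (hz.sub heven)
  convert! h using 1
  · ext n
    push_cast
    rw [pow_succ]
    ring
  · simp [hk0]
    ring

lemma integral_fermi {k : ℕ} (hk : 1 < k) {z : ℝ}
    (hz : HasSum (fun n : ℕ => 1 / (n : ℝ) ^ k) z) :
    ∫ x in Set.Ioi (0 : ℝ), x ^ (k - 1) * (Real.exp x + 1)⁻¹ =
      (k - 1).factorial * ((1 - 2 / 2 ^ k) * z) := by
  have hη := hasSum_dirichlet_eta hk hz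
  have hM := hasSum_mellin (a := fun n : ℕ => (-1 : ℂ) ^ n) (p := fun n : ℕ => (n + 1 : ℝ))
    (F := fun t => (((Real.exp t + 1)⁻¹ : ℝ) : ℂ)) (s := k)
    (fun n => Or.inr (by positivity)) (by simp; omega)
    (fun t ht => by
      have := Complex.hasSum_ofReal.2 (hasSum_fermi ht)
      convert! this using 2 with n
      push_cast
      rfl)
    (by
      have := (summable_nat_add_iff 1).2 hz.summable
      simpa using this)
  have hΓ : Complex.Gamma k = ((k - 1).factorial : ℂ) := by
    obtain ⟨m, rfl⟩ : ∃ m, k = m + 1 := ⟨k - 1, by omega⟩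
    simpa using Complex.Gamma_nat_eq_factorial m
  have hη' := (Complex.hasSum_ofReal.2 hη).mul_left ((k - 1).factorial : ℂ)
  have hEq := hM.unique (a₂ := (((k - 1).factorial * ((1 - 2 / 2 ^ k) * z) : ℝ) : ℂ)) (by
    convert! hη' using 1
    · ext n
      simp [hΓ]
      ring
    · push_cast
      ring)
  rw [mellin] at hEq
  rw [← Complex.ofReal_inj, ← hEq, ← integral_complex_ofReal]
  refine setIntegral_congr_fun measurableSet_Ioi fun x hx => ?_
  obtain ⟨m, rfl⟩ : ∃ m, k = m + 1 := ⟨k - 1, by omega⟩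
  simp

local notation "E2" => EuclideanSpace ℝ (Fin 2)

lemma integral_eq_zero_of_comp_neg {f : E2 → ℝ} (hf : ∀ p, f (-p) = -f p) :
    ∫ p, f p = 0 := by
  have h := integral_neg_eq_self f (volume : Measure E2)
  simp_rw [hf, integral_neg] at h
  linarith

lemma integrable_radial_mul {f : ℝ → ℝ} (hf : Continuous f)
    (hint : ∀ k : ℕ, Integrable fun p : E2 => f ‖p‖ * ‖p‖ ^ k)
    {g : E2 → ℝ} (hg : Continuous g) {C : ℝ} {k : ℕ} (hgC : ∀ p, |g p| ≤ C * ‖p‖ ^ k) :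
    Integrable fun p => f ‖p‖ * g p := by
  refine ((hint k).norm.const_mul C).mono' (by fun_prop) (.of_forall fun p => ?_)
  rw [norm_mul, norm_mul, norm_pow, norm_norm]
  calc ‖f ‖p‖‖ * ‖g p‖ ≤ ‖f ‖p‖‖ * (C * ‖p‖ ^ k) := by gcongr; exact hgC p
    _ = C * (‖f ‖p‖‖ * ‖p‖ ^ k) := by ring

lemma integrable_radial_mul_inner {f : ℝ → ℝ} (hf : Continuous f)
    (hint : ∀ k : ℕ, Integrable fun p : E2 => f ‖p‖ * ‖p‖ ^ k) (u : E2) :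
    Integrable fun p => f ‖p‖ * ⟪p, u⟫ :=
  integrable_radial_mul hf hint (C := ‖u‖) (k := 1) (by fun_prop) fun p => by
    rw [pow_one, mul_comm]
    exact abs_real_inner_le_norm p u

lemma integrable_radial_mul_inner_mul_inner {f : ℝ → ℝ} (hf : Continuous f)
    (hint : ∀ k : ℕ, Integrable fun p : E2 => f ‖p‖ * ‖p‖ ^ k) (u v : E2) :
    Integrable fun p => f ‖p‖ * (⟪p, v⟫ * ⟪p, u⟫) :=
  integrable_radial_mul hf hint (C := ‖v‖ * ‖u‖) (k := 2) (by fun_prop) fun p => by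
    rw [abs_mul]
    calc |⟪p, v⟫| * |⟪p, u⟫| ≤ (‖p‖ * ‖v‖) * (‖p‖ * ‖u‖) := by
          gcongr <;> exact abs_real_inner_le_norm _ _
      _ = ‖v‖ * ‖u‖ * ‖p‖ ^ 2 := by ring

/-- Averaging over a quarter turn evaluates the second moments of a radial weight. -/
lemma integral_radial_mul_inner_mul_inner {f : ℝ → ℝ} (hf : Continuous f)
    (hint : ∀ k : ℕ, Integrable fun p : E2 => f ‖p‖ * ‖p‖ ^ k) (u v : E2) :
    ∫ p : E2, f ‖p‖ * (⟪p, v⟫ * ⟪p, u⟫) = ⟪v, u⟫ / 2 * ∫ p : E2, f ‖p‖ * ‖p‖ ^ 2 := by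
  have : Fact (Module.finrank ℝ E2 = 2) := ⟨by simp⟩
  let o : Orientation ℝ E2 (Fin 2) := (EuclideanSpace.basisFun (Fin 2) ℝ).toBasis.orientation
  have hrot : ∫ p : E2, f ‖p‖ * (o.areaForm p v * o.areaForm p u) =
      ∫ p : E2, f ‖p‖ * (⟪p, v⟫ * ⟪p, u⟫) := by
    have h := o.rightAngleRotation.measurePreserving.integral_comp
      o.rightAngleRotation.toHomeomorph.measurableEmbedding
      (fun p : E2 => f ‖p‖ * (⟪p, v⟫ * ⟪p, u⟫))
    simpa only [LinearIsometryEquiv.norm_map, o.inner_rightAngleRotation_left] using h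
  have hint' : Integrable fun p : E2 => f ‖p‖ * (o.areaForm p v * o.areaForm p u) := by
    have h := (o.rightAngleRotation.measurePreserving.integrable_comp_emb
      o.rightAngleRotation.toHomeomorph.measurableEmbedding).2
      (integrable_radial_mul_inner_mul_inner hf hint u v)
    simpa only [Function.comp_def, LinearIsometryEquiv.norm_map,
      o.inner_rightAngleRotation_left] using h
  have hsum := integral_add (integrable_radial_mul_inner_mul_inner hf hint u v) hint'
  rw [hrot] at hsum
  have hpt : ∀ p : E2, f ‖p‖ * (⟪p, v⟫ * ⟪p, u⟫) + f ‖p‖ * (o.areaForm p v * o.areaForm p u) =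
      ⟪v, u⟫ * (f ‖p‖ * ‖p‖ ^ 2) := fun p => by
    linear_combination f ‖p‖ * o.inner_mul_inner_add_areaForm_mul_areaForm p v u
  simp_rw [hpt, integral_const_mul] at hsum
  linarith

lemma integral_radial_mul_quadratic {f : ℝ → ℝ} (hf : Continuous f)
    (hint : ∀ k : ℕ, Integrable fun p : E2 => f ‖p‖ * ‖p‖ ^ k) (u : E2) (a b c d : ℝ) :
    ∫ p : E2, f ‖p‖ * (a + b * ‖p‖ ^ 2 + c * ⟪p, u⟫ + d * ⟪p, u⟫ ^ 2) =
      a * (∫ p : E2, f ‖p‖) + (b + d * ‖u‖ ^ 2 / 2) * ∫ p : E2, f ‖p‖ * ‖p‖ ^ 2 := by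
  have h0 : Integrable fun p : E2 => f ‖p‖ := by simpa using hint 0
  have hlin := integrable_radial_mul_inner hf hint u
  have hquad := integrable_radial_mul_inner_mul_inner hf hint u u
  have hodd : ∫ p : E2, f ‖p‖ * ⟪p, u⟫ = 0 :=
    integral_eq_zero_of_comp_neg fun p => by simp
  have hpt : ∀ p : E2, f ‖p‖ * (a + b * ‖p‖ ^ 2 + c * ⟪p, u⟫ + d * ⟪p, u⟫ ^ 2) =
      a * f ‖p‖ + b * (f ‖p‖ * ‖p‖ ^ 2) + c * (f ‖p‖ * ⟪p, u⟫) +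
        d * (f ‖p‖ * (⟪p, u⟫ * ⟪p, u⟫)) := fun p => by ring
  simp_rw [hpt]
  rw [integral_add (((h0.const_mul a).fun_add ((hint 2).const_mul b)).fun_add (hlin.const_mul c))
      (hquad.const_mul d),
    integral_add ((h0.const_mul a).fun_add ((hint 2).const_mul b)) (hlin.const_mul c),
    integral_add (h0.const_mul a) ((hint 2).const_mul b)]
  simp_rw [integral_const_mul]
  rw [hodd, integral_radial_mul_inner_mul_inner hf hint, real_inner_self_eq_norm_sq]
  ring

lemma integral_inner_mul_radial_mul_quadratic {f : ℝ → ℝ} (hf : Continuous f)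
    (hint : ∀ k : ℕ, Integrable fun p : E2 => f ‖p‖ * ‖p‖ ^ k) (u v : E2) (a b c d : ℝ) :
    ∫ p : E2, ⟪p, v⟫ * (f ‖p‖ * (a + b * ‖p‖ ^ 2 + c * ⟪p, u⟫ + d * ⟪p, u⟫ ^ 2)) =
      c * ⟪v, u⟫ / 2 * ∫ p : E2, f ‖p‖ * ‖p‖ ^ 2 := by
  have hbound : ∀ p : E2, |⟪p, v⟫ * (a + b * ‖p‖ ^ 2 + d * ⟪p, u⟫ ^ 2)| ≤
      ‖v‖ * (|a| * ‖p‖ ^ 1 + (|b| + |d| * ‖u‖ ^ 2) * ‖p‖ ^ 3) := fun p => by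
    have h1 := abs_real_inner_le_norm p v
    have h2 := abs_real_inner_le_norm p u
    rw [abs_mul]
    calc _ ≤ (‖p‖ * ‖v‖) * (|a| + |b| * ‖p‖ ^ 2 + |d| * (‖p‖ * ‖u‖) ^ 2) := by
          gcongr
          refine (abs_add_three _ _ _).trans ?_
          rw [abs_mul, abs_mul, abs_pow, abs_pow, abs_norm]
          gcongr
      _ = _ := by ring
  have hoddint : Integrable fun p : E2 =>
      f ‖p‖ * (⟪p, v⟫ * (a + b * ‖p‖ ^ 2 + d * ⟪p, u⟫ ^ 2)) := by
    refine ((((hint 1).norm.const_mul |a|).add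
      ((hint 3).norm.const_mul (|b| + |d| * ‖u‖ ^ 2))).const_mul ‖v‖).mono'
      (by fun_prop) (.of_forall fun p => ?_)
    simp only [norm_mul, norm_pow, norm_norm, Pi.add_apply]
    have := mul_le_mul_of_nonneg_left (hbound p) (norm_nonneg (f ‖p‖))
    rw [← Real.norm_eq_abs, norm_mul] at this
    linarith
  have hodd : ∫ p : E2, f ‖p‖ * (⟪p, v⟫ * (a + b * ‖p‖ ^ 2 + d * ⟪p, u⟫ ^ 2)) = 0 :=
    integral_eq_zero_of_comp_neg fun p => by simp
  have hpt : ∀ p : E2,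
      ⟪p, v⟫ * (f ‖p‖ * (a + b * ‖p‖ ^ 2 + c * ⟪p, u⟫ + d * ⟪p, u⟫ ^ 2)) =
      f ‖p‖ * (⟪p, v⟫ * (a + b * ‖p‖ ^ 2 + d * ⟪p, u⟫ ^ 2)) +
        c * (f ‖p‖ * (⟪p, v⟫ * ⟪p, u⟫)) := fun p => by ring
  simp_rw [hpt]
  rw [integral_add hoddint
      ((integrable_radial_mul_inner_mul_inner hf hint u v).const_mul c),
    integral_const_mul, hodd, integral_radial_mul_inner_mul_inner hf hint]
  ring

lemma integrable_fermi_mul_pow {β : ℝ} (hβ : 0 < β) (k : ℕ) :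
    Integrable fun p : E2 => (Real.exp (β * ‖p‖ ^ 2 / 2) + 1)⁻¹ * ‖p‖ ^ k := by
  have hgauss : Integrable fun p : E2 => ‖p‖ ^ k * Real.exp (-(β / 2) * ‖p‖ ^ 2) := by
    rw [integrable_fun_norm_addHaar volume
      (f := fun r : ℝ => r ^ k * Real.exp (-(β / 2) * r ^ 2))]
    have h := integrableOn_rpow_mul_exp_neg_mul_sq (half_pos hβ) (s := (k + 1 : ℕ))
      (by push_cast; linarith [(k.cast_nonneg : (0 : ℝ) ≤ k)])
    refine h.congr_fun (fun r _ => ?_) measurableSet_Ioi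
    simp only [Real.rpow_natCast, finrank_euclideanSpace, Fintype.card_fin, smul_eq_mul]
    ring
  refine hgauss.mono' (Continuous.aestronglyMeasurable ?_) (.of_forall fun p => ?_)
  · exact (Continuous.inv₀ (by fun_prop) fun p => by positivity).mul (by fun_prop)
  · rw [Real.norm_of_nonneg (by positivity), mul_comm]
    gcongr
    rw [show -(β / 2) * ‖p‖ ^ 2 = -(β * ‖p‖ ^ 2 / 2) by ring, Real.exp_neg]
    gcongr
    linarith

/-- Integration of a function of the kinetic energy in the plane. -/
lemma integral_comp_energy {β : ℝ} (hβ : 0 < β) (g : ℝ → ℝ) :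
    ∫ p : E2, g (β * ‖p‖ ^ 2 / 2) = 2 * Real.pi / β * ∫ x in Set.Ioi (0 : ℝ), g x := by
  have hvol : (volume : Measure E2).real (Metric.ball 0 1) = Real.pi := by
    simp [Measure.real, Real.pi_pos.le]
  rw [integral_fun_norm_addHaar volume (fun r => g (β * r ^ 2 / 2)), hvol]
  have h1 := integral_comp_mul_left_Ioi g 0 (half_pos hβ)
  have h2 := integral_comp_rpow_Ioi_of_pos (g := fun x => g (β / 2 * x)) two_pos
  rw [mul_zero] at h1
  have h3 : ∫ x in Set.Ioi (0 : ℝ), ((2 : ℝ) * x ^ ((2 : ℝ) - 1)) • g (β / 2 * x ^ (2 : ℝ)) =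
      2 * ∫ r in Set.Ioi (0 : ℝ), r ^ (Module.finrank ℝ E2 - 1) • g (β * r ^ 2 / 2) := by
    rw [← integral_const_mul]
    refine setIntegral_congr_fun measurableSet_Ioi fun r _ => ?_
    have : (2 : ℝ) - 1 = 1 := by norm_num
    simp only [this, Real.rpow_one, Real.rpow_two, finrank_euclideanSpace, Fintype.card_fin,
      smul_eq_mul]
    rw [mul_div_right_comm]
    ring
  rw [h3, h1] at h2
  simp only [smul_eq_mul, nsmul_eq_mul, finrank_euclideanSpace, Fintype.card_fin] at h2 ⊢
  push_cast
  rw [mul_left_comm, h2]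
  field_simp

lemma hasSum_of_riemannZeta_three {z : ℝ} (hz : (z : ℂ) = riemannZeta 3) :
    HasSum (fun n : ℕ => 1 / (n : ℝ) ^ 3) z := by
  have hs : Summable (fun n : ℕ => 1 / (n : ℝ) ^ 3) :=
    Real.summable_one_div_nat_pow.2 (by norm_num)
  have h := zeta_nat_eq_tsum_of_gt_one (k := 3) (by norm_num)
  have hz' : z = ∑' n : ℕ, 1 / (n : ℝ) ^ 3 := by
    apply Complex.ofReal_injective
    push_cast at h ⊢
    rw [hz, h]
  exact hz' ▸ hs.hasSum

lemma integral_fermi_norm {β : ℝ} (hβ : 0 < β) :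
    ∫ p : E2, (Real.exp (β * ‖p‖ ^ 2 / 2) + 1)⁻¹ = 2 * Real.pi / β * Real.log 2 := by
  rw [integral_comp_energy hβ (fun x => (Real.exp x + 1)⁻¹), integral_fermi_zero]

lemma integral_fermi_mul_norm_sq {β : ℝ} (hβ : 0 < β) :
    ∫ p : E2, (Real.exp (β * ‖p‖ ^ 2 / 2) + 1)⁻¹ * ‖p‖ ^ 2 =
      2 / β * (2 * Real.pi / β * (Real.pi ^ 2 / 12)) := by
  have h := integral_comp_energy hβ (fun x => x ^ (2 - 1) * (Real.exp x + 1)⁻¹)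
  rw [integral_fermi one_lt_two hasSum_zeta_two] at h
  have hpt : ∀ p : E2, (Real.exp (β * ‖p‖ ^ 2 / 2) + 1)⁻¹ * ‖p‖ ^ 2 =
      2 / β * ((β * ‖p‖ ^ 2 / 2) ^ (2 - 1) * (Real.exp (β * ‖p‖ ^ 2 / 2) + 1)⁻¹) := fun p => by
    field_simp
    ring
  simp_rw [hpt, integral_const_mul, h]
  norm_num [Nat.factorial, -mul_eq_mul_left_iff]
  ring

lemma integral_fermi_mul_norm_pow_four {β : ℝ} (hβ : 0 < β) {z : ℝ}
    (hz : HasSum (fun n : ℕ => 1 / (n : ℝ) ^ 3) z) :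
    ∫ p : E2, (Real.exp (β * ‖p‖ ^ 2 / 2) + 1)⁻¹ * ‖p‖ ^ 4 =
      (2 / β) ^ 2 * (2 * Real.pi / β * (3 / 2 * z)) := by
  have h := integral_comp_energy hβ (fun x => x ^ (3 - 1) * (Real.exp x + 1)⁻¹)
  rw [integral_fermi (by norm_num) hz] at h
  have hpt : ∀ p : E2, (Real.exp (β * ‖p‖ ^ 2 / 2) + 1)⁻¹ * ‖p‖ ^ 4 =
      (2 / β) ^ 2 *
        ((β * ‖p‖ ^ 2 / 2) ^ (3 - 1) * (Real.exp (β * ‖p‖ ^ 2 / 2) + 1)⁻¹) := fun p => by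
    field_simp
    ring
  simp_rw [hpt, integral_const_mul, h]
  norm_num [Nat.factorial, -mul_eq_mul_left_iff]
  ring

/-- Moment exactness of the 2D polynomial equilibrium ansatz: the polynomial
approximation of the Fermi-Dirac equilibrium reproduces the prescribed density
matrix `ρ`, velocity `u` and internal energy `ε`. Here `z3` denotes the real
number equal to `ζ(3)`. -/
theorem poly_equilibrium_moments_2d
    (β₀ ε : ℝ) (hβ₀ : 0 < β₀) (u : EuclideanSpace ℝ (Fin 2))
    (ρ : Matrix (Fin 2) (Fin 2) ℂ) (hρ : ρ.IsHermitian)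
    (z3 : ℝ) (hz3 : (z3 : ℂ) = riemannZeta 3)
    (n₀ αfac α₁ α₂ α₃ α₄ α₅ : ℝ)
    (hn₀ : n₀ = (2 * Real.pi / β₀) * Real.log 2)
    (hαfac : αfac = 72 * Real.log 2 / (216 * Real.log 2 * z3 - Real.pi ^ 4))
    (hα₁ : α₁ = αfac * (3 * z3 - Real.pi ^ 2 / 6 * (β₀ * ε)))
    (hα₂ : α₂ = αfac * (2 * Real.log 2 * (β₀ * ε) - Real.pi ^ 2 / 6))
    (hα₃ : α₃ = 12 * Real.log 2 / Real.pi ^ 2)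
    (hα₄ : α₄ = αfac * Real.log 2)
    (hα₅ : α₅ = -(αfac * Real.pi ^ 2 / 6))
    (Weq : EuclideanSpace ℝ (Fin 2) → Matrix (Fin 2) (Fin 2) ℂ)
    (hWeq : ∀ p, Weq p =
      ((((1 / n₀) * (Real.exp (β₀ * ‖p‖ ^ 2 / 2) + 1)⁻¹ *
        (α₁ + α₂ * (β₀ * (‖p‖ ^ 2 / 2)) + α₃ * (β₀ * ⟪p, u⟫) +
          α₄ * (β₀ * ⟪p, u⟫) ^ 2 + α₅ * (β₀ * (‖u‖ ^ 2 / 2))) : ℝ) : ℂ)) • ρ) :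
    (∀ i j, (∫ p, Weq p i j) = ρ i j) ∧
    (∀ k : Fin 2, (∫ p, (p k : ℂ) * (Weq p).trace) = ρ.trace * (u k : ℂ)) ∧
    (∫ p, ((‖p‖ ^ 2 / 2 : ℝ) : ℂ) * (Weq p).trace)
      = ρ.trace * ((ε + ‖u‖ ^ 2 / 2 : ℝ) : ℂ) := by
  have hz := hasSum_of_riemannZeta_three hz3
  have hβ : β₀ ≠ 0 := hβ₀.ne'
  have hπ : Real.pi ≠ 0 := Real.pi_ne_zero
  have hlog : Real.log 2 ≠ 0 := (Real.log_pos one_lt_two).ne'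
  have hD : 216 * Real.log 2 * z3 - Real.pi ^ 4 ≠ 0 := by
    have h1 : 1 ≤ z3 := by simpa using le_hasSum hz 1 fun n _ => by positivity
    have h2 : Real.pi ^ 4 < 3.15 ^ 4 := by gcongr; exact Real.pi_lt_d2
    have h3 := Real.log_two_gt_d9
    nlinarith
  have hfac : αfac * (216 * Real.log 2 * z3 - Real.pi ^ 4) = 72 * Real.log 2 := by
    rw [hαfac, div_mul_cancel₀ _ hD]
  set f : ℝ → ℝ := fun r => (Real.exp (β₀ * r ^ 2 / 2) + 1)⁻¹ with hf_def
  have hf : Continuous f := Continuous.inv₀ (by fun_prop) fun r => by positivity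
  have hint : ∀ k : ℕ, Integrable fun p : E2 => f ‖p‖ * ‖p‖ ^ k := integrable_fermi_mul_pow hβ₀
  have hint' : ∀ k : ℕ, Integrable fun p : E2 => (f ‖p‖ * ‖p‖ ^ 2) * ‖p‖ ^ k := fun k => by
    simpa only [mul_assoc, ← pow_add] using hint (2 + k)
  have hR0 : ∫ p : E2, f ‖p‖ = 2 * Real.pi / β₀ * Real.log 2 := integral_fermi_norm hβ₀
  have hR2 : ∫ p : E2, f ‖p‖ * ‖p‖ ^ 2 = _ := integral_fermi_mul_norm_sq hβ₀
  have hR4 : ∫ p : E2, (f ‖p‖ * ‖p‖ ^ 2) * ‖p‖ ^ 2 =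
      (2 / β₀) ^ 2 * (2 * Real.pi / β₀ * (3 / 2 * z3)) := by
    simpa only [mul_assoc, ← pow_add] using integral_fermi_mul_norm_pow_four hβ₀ hz
  set P : E2 → ℝ := fun p => (α₁ + α₅ * β₀ * ‖u‖ ^ 2 / 2) + (α₂ * β₀ / 2) * ‖p‖ ^ 2 +
    (α₃ * β₀) * ⟪p, u⟫ + (α₄ * β₀ ^ 2) * ⟪p, u⟫ ^ 2 with hP
  have hW : ∀ p, Weq p = ((1 / n₀ * (f ‖p‖ * P p) : ℝ) : ℂ) • ρ := fun p => by
    rw [hWeq]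
    congr 2
    simp only [hP, hf_def]
    ring
  have htr : ∀ p, (Weq p).trace = ((1 / n₀ * (f ‖p‖ * P p) : ℝ) : ℂ) * ρ.trace := fun p => by
    rw [hW, Matrix.trace_smul, smul_eq_mul]
  have hdensity : ∫ p, 1 / n₀ * (f ‖p‖ * P p) = 1 := by
    rw [integral_const_mul, integral_radial_mul_quadratic hf hint, hR0, hR2, hn₀, hα₅, hα₄, hα₂,
      hα₁]
    field_simp
    linear_combination 2 * hfac
  have hmomentum : ∀ v : E2, ∫ p, ⟪p, v⟫ * (1 / n₀ * (f ‖p‖ * P p)) = ⟪v, u⟫ := fun v => by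
    simp_rw [mul_left_comm _ (1 / n₀)]
    rw [integral_const_mul, integral_inner_mul_radial_mul_quadratic hf hint, hR2, hn₀, hα₃]
    field_simp
  have henergy : ∫ p, ‖p‖ ^ 2 / 2 * (1 / n₀ * (f ‖p‖ * P p)) = ε + ‖u‖ ^ 2 / 2 := by
    have hpt : ∀ p : E2, ‖p‖ ^ 2 / 2 * (1 / n₀ * (f ‖p‖ * P p)) =
        1 / (2 * n₀) * ((f ‖p‖ * ‖p‖ ^ 2) * P p) := fun p => by
      ring
    simp_rw [hpt]
    rw [integral_const_mul, integral_radial_mul_quadratic (f := fun r => f r * r ^ 2)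
      (by fun_prop) hint', hR2, hR4, hn₀, hα₅, hα₄, hα₂, hα₁]
    field_simp
    linear_combination (2 * β₀ * ε + β₀ * ‖u‖ ^ 2) * hfac
  refine ⟨fun i j => ?_, fun k => ?_, ?_⟩
  · simp_rw [hW, Matrix.smul_apply, smul_eq_mul]
    rw [integral_mul_const, integral_complex_ofReal, hdensity, Complex.ofReal_one, one_mul]
  · have h := hmomentum (EuclideanSpace.single k 1)
    simp only [EuclideanSpace.inner_single_right, EuclideanSpace.inner_single_left, map_one,
      one_mul, conj_trivial] at h
    simp_rw [htr, ← mul_assoc, ← Complex.ofReal_mul]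
    rw [integral_mul_const, integral_complex_ofReal, mul_comm]
    congr 2
    simpa only [mul_assoc] using h
  · simp_rw [htr, ← mul_assoc, ← Complex.ofReal_mul]
    rw [integral_mul_const, integral_complex_ofReal, mul_comm]
    congr 2
    simpa only [mul_assoc] using henergy
end
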